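/- arXiv:2205.13893 — 3 statements merged into one kernel-verified Lean document; each statement's English description precedes it below -/
import Mathlib

section
/- Let 0 < α < 1/4 and p > 3/(1−α) with p < ∞, and write r = √(x_1² + x_2²). Then there exists a constant C>0 such that for all f ∈ C_0^∞(ℝ³), ‖ f / ( |x_3|^{α/2} r^{1/2} ) ‖_{L^{2p/(p−1)}(ℝ³)} ≤ C ‖ f ‖_{L^2(ℝ³)}^{(p−3−pα)/(2p)} ‖ ∇f ‖_{L^2(ℝ³)}^{(p+3+pα)/(2p)}. -/
open MeasureTheory ENNReal Real

theorem exists_params (α q : ℝ) (hα0 : 0 < α) (hα : α < 1 / 4) (hq2 : 2 < q)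
    (hq : q * (1 + α / 2) < 3) :
    ∃ t₁ t₁' t₂ t₃ : ℝ, 0 ≤ t₁ ∧ 0 ≤ t₁' ∧ 0 ≤ t₂ ∧ 0 ≤ t₃ ∧ t₁ + t₁' + t₂ + t₃ = 1 ∧
      2 + 2 * t₁ + 4 * t₃ = q ∧ α * q / 2 < t₁ + t₁' ∧ q / 4 < t₂ := by
  have h0 : 0 < α * q := by positivity
  by_cases h : α * q / 2 < (q - 2) / 2
  · have h1 : α * q / 2 < min ((q - 2) / 2) (3 - q) := lt_min h (by nlinarith)
    obtain ⟨s, hs1, hs2⟩ := exists_between h1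
    rw [lt_min_iff] at hs2
    refine ⟨s, 0, 1 - s - (q - 2 - 2 * s) / 4, (q - 2 - 2 * s) / 4, ?_, ?_, ?_, ?_, ?_, ?_, ?_, ?_⟩ <;> linarith
  · have h1 : α * q / 2 < 1 - q / 4 := by nlinarith
    obtain ⟨s, hs1, hs2⟩ := exists_between h1
    refine ⟨(q - 2) / 2, s - (q - 2) / 2, 1 - s, 0, ?_, ?_, ?_, ?_, ?_, ?_, ?_, ?_⟩ <;> linarith


theorem lint_abs (a R : ℝ) (ha : a < 1) (hR : 0 < R) :
    ∫⁻ t in Set.Icc (-R) R, ENNReal.ofReal (|t| ^ (-a)) ≤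
      ENNReal.ofReal (2 / (1 - a) * R ^ (1 - a)) := by
  have h1 : ∫⁻ t in Set.Ioc 0 R, ENNReal.ofReal (|t| ^ (-a)) =
      ENNReal.ofReal (1 / (1 - a) * R ^ (1 - a)) := by
    have hi := (intervalIntegral.intervalIntegrable_rpow' (a := 0) (b := R) (r := -a) (by linarith))
    rw [intervalIntegrable_iff_integrableOn_Ioc_of_le hR.le] at hi
    have h2 := integral_rpow (a := 0) (b := R) (r := -a) (Or.inl (by linarith))
    rw [intervalIntegral.integral_of_le hR.le] at h2
    rw [Real.zero_rpow (by linarith), sub_zero, neg_add_eq_sub] at h2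
    rw [one_div, inv_mul_eq_div, ← h2, ofReal_integral_eq_lintegral_ofReal hi]
    · refine setLIntegral_congr_fun measurableSet_Ioc fun t ht => ?_
      rw [Set.mem_Ioc] at ht
      simp only [abs_of_pos ht.1]
    · filter_upwards [self_mem_ae_restrict measurableSet_Ioc] with t ht
      exact Real.rpow_nonneg ht.1.le _
  have h2 : ∫⁻ t in Set.Ico (-R) 0, ENNReal.ofReal (|t| ^ (-a)) =
      ∫⁻ t in Set.Ioc 0 R, ENNReal.ofReal (|t| ^ (-a)) := by
    have := (Measure.measurePreserving_neg (volume : Measure ℝ)).setLIntegral_comp_preimage_emb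
      (MeasurableEquiv.neg ℝ).measurableEmbedding (fun t => ENNReal.ofReal (|t| ^ (-a))) (Set.Ioc 0 R)
    simpa using this
  have h3 : Set.Icc (-R) R ⊆ (Set.Ico (-R) 0 ∪ {0}) ∪ Set.Ioc 0 R := by
    intro t ht
    rcases lt_trichotomy t 0 with h | h | h
    · exact Or.inl (Or.inl ⟨ht.1, h⟩)
    · exact Or.inl (Or.inr h)
    · exact Or.inr ⟨h, ht.2⟩
  calc _ ≤ _ := lintegral_mono_set h3
    _ ≤ _ := lintegral_union_le _ _ _
    _ ≤ ((∫⁻ t in Set.Ico (-R) 0, ENNReal.ofReal (|t| ^ (-a))) + ∫⁻ t in ({0} : Set ℝ), ENNReal.ofReal (|t| ^ (-a))) + _ :=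
        add_le_add_left (lintegral_union_le _ _ _) _
    _ = _ := by
        rw [h2, h1]
        simp only [Measure.restrict_singleton, Real.volume_singleton, zero_smul, lintegral_zero_measure, add_zero]
        have : 0 < 1 - a := by linarith
        rw [← ENNReal.ofReal_add (by positivity) (by positivity)]
        congr 1; ring

theorem weight1D (a R : ℝ) (ha0 : 0 < a) (ha : a < 1) (hR : 0 < R) (u : ℝ → ℝ)
    (hu : ContDiff ℝ 1 u) (hc : HasCompactSupport u) :
    ∫⁻ t, ‖u t‖ₑ * ENNReal.ofReal (|t| ^ (-a)) ≤
      ENNReal.ofReal (2 / (1 - a) * R ^ (1 - a)) * (∫⁻ t, ‖deriv u t‖ₑ) +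
      ENNReal.ofReal (R ^ (-a)) * ∫⁻ t, ‖u t‖ₑ := by
  set K := ∫⁻ t, ‖deriv u t‖ₑ with hK
  have hsup : ∀ t, ‖u t‖ₑ ≤ K := fun t =>
    (hc.enorm_le_lintegral_Ici_deriv hu t).trans (setLIntegral_le_lintegral _ _)
  have hm : Measurable (fun t : ℝ => ENNReal.ofReal (|t| ^ (-a))) := by fun_prop
  calc ∫⁻ t, ‖u t‖ₑ * ENNReal.ofReal (|t| ^ (-a))
      ≤ ∫⁻ t, (Set.Icc (-R) R).indicator (fun t => K * ENNReal.ofReal (|t| ^ (-a))) t +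
          ENNReal.ofReal (R ^ (-a)) * ‖u t‖ₑ := by
        refine lintegral_mono fun t => ?_
        by_cases h : t ∈ Set.Icc (-R) R
        · rw [Set.indicator_of_mem h]
          exact le_add_right (by gcongr; exact hsup t)
        · rw [Set.indicator_of_notMem h, zero_add, mul_comm]
          gcongr ?_ * _
          apply ENNReal.ofReal_le_ofReal
          apply Real.rpow_le_rpow_of_nonpos hR _ (by linarith)
          by_contra! h'
          exact h (abs_le.1 h'.le)
    _ = _ := by
        rw [lintegral_add_left (by measurability), lintegral_indicator measurableSet_Icc,
          lintegral_const_mul _ hm, lintegral_const_mul _ (by have := hu.continuous; fun_prop)]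
    _ ≤ _ := by
        rw [mul_comm K]
        gcongr
        exact lint_abs a R ha hR

theorem fubini2 (F : (Fin 3 → ℝ) → ℝ≥0∞) (hF : Measurable F) :
    ∫⁻ x, F x = ∫⁻ y : Fin 2 → ℝ, ∫⁻ t : ℝ, F (Fin.insertNth 2 t y) := by
  have := (volume_preserving_piFinSuccAbove (fun _ : Fin 3 => ℝ) 2).symm
  rw [← this.lintegral_comp hF, Measure.volume_eq_prod, lintegral_prod_symm' _ (by fun_prop)]
  rfl

theorem weight3 (a R : ℝ) (ha0 : 0 < a) (ha : a < 1) (hR : 0 < R) (u : (Fin 3 → ℝ) → ℝ)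
    (hu : ContDiff ℝ 1 u) (hc : HasCompactSupport u) :
    ∫⁻ x, ‖u x‖ₑ * ENNReal.ofReal (|x 2| ^ (-a)) ≤
      ENNReal.ofReal (2 / (1 - a) * R ^ (1 - a)) * (∫⁻ x, ‖fderiv ℝ u x‖ₑ) +
      ENNReal.ofReal (R ^ (-a)) * ∫⁻ x, ‖u x‖ₑ := by
  have hcu := hu.continuous
  have hcd : Continuous (fderiv ℝ u) := hu.continuous_fderiv (by norm_num)
  have m1 : Measurable (fun x => ‖u x‖ₑ) := by fun_prop
  have m2 : Measurable (fun x => ‖fderiv ℝ u x‖ₑ) := by fun_prop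
  have hins : Measurable (fun p : (Fin 2 → ℝ) × ℝ => (Fin.insertNth 2 p.2 p.1 : Fin 3 → ℝ)) := by
    have : Continuous (fun p : (Fin 2 → ℝ) × ℝ => (Fin.insertNth 2 p.2 p.1 : Fin 3 → ℝ)) := by
      fun_prop
    exact this.measurable
  rw [fubini2 _ (by fun_prop), fubini2 _ m1, fubini2 _ m2]
  have M1 : Measurable (fun y : Fin 2 → ℝ => ∫⁻ t : ℝ, ‖u (Fin.insertNth 2 t y)‖ₑ) :=
    (m1.comp hins).lintegral_prod_right'
  have M2 : Measurable (fun y : Fin 2 → ℝ => ∫⁻ t : ℝ, ‖fderiv ℝ u (Fin.insertNth 2 t y)‖ₑ) :=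
    (m2.comp hins).lintegral_prod_right'
  rw [← lintegral_const_mul _ M1, ← lintegral_const_mul _ M2,
    ← lintegral_add_left (M2.const_mul _)]
  refine lintegral_mono fun y => ?_
  have hd : ∀ t : ℝ, HasDerivAt (fun t : ℝ => (Fin.insertNth 2 t y : Fin 3 → ℝ)) (Pi.single 2 1) t := by
    intro t
    rw [hasDerivAt_pi]
    intro i
    refine Fin.succAboveCases 2 ?_ (fun j => ?_) i
    · simpa using hasDerivAt_id' t
    · simpa [Fin.succAbove_ne] using hasDerivAt_const t (y j)
  have hins1 : ContDiff ℝ 1 (fun t : ℝ => (Fin.insertNth 2 t y : Fin 3 → ℝ)) := by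
    rw [contDiff_pi]
    intro i
    refine Fin.succAboveCases 2 ?_ (fun j => ?_) i
    · simpa using contDiff_fun_id
    · simpa using contDiff_const
  have hcs : HasCompactSupport (fun t : ℝ => u (Fin.insertNth 2 t y)) := by
    refine HasCompactSupport.of_support_subset_isCompact
      (K := (fun x : Fin 3 → ℝ => x 2) '' tsupport u) (hc.image (continuous_apply 2)) ?_
    intro t ht
    exact ⟨_, subset_tsupport _ ht, by simp⟩
  have := weight1D a R ha0 ha hR (fun t : ℝ => u (Fin.insertNth 2 t y)) (hu.comp hins1) hcs
  have e : ∀ t : ℝ, (Fin.insertNth 2 t y : Fin 3 → ℝ) 2 = t := fun t => by simp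
  simp only [e]
  refine this.trans ?_
  gcongr with t
  have h1 : HasDerivAt (fun t : ℝ => u (Fin.insertNth 2 t y))
      (fderiv ℝ u (Fin.insertNth 2 t y) (Pi.single 2 1)) t :=
    ((hu.differentiable (by norm_num)) _).hasFDerivAt.comp_hasDerivAt t (hd t)
  rw [h1.deriv]
  refine (ContinuousLinearMap.le_opENorm _ _).trans ?_
  have e1 : ‖(Pi.single 2 1 : Fin 3 → ℝ)‖ₑ = 1 := by
    rw [← ofReal_norm, Pi.norm_single]; simp
  rw [e1, mul_one]

theorem pointwiseR (b R s φ G X : ℝ) (hb1 : 1 < b) (hb2 : b < 2) (hR : 0 < R) (hs : 0 < s)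
    (hG : 0 ≤ G) (hX : |X| ≤ 4 * |φ| * G * (√s * s ^ (-b / 2))) :
    -X ≤ (2 - b) / 2 * (φ ^ 2 * s ^ (-b / 2)) +
      8 / (2 - b) * (R ^ (-b) * φ ^ 2 + R ^ 2 * R ^ (-b) * G ^ 2) := by
  have h2b : 0 < 2 - b := by linarith
  have hRb : 0 < R ^ (-b) := by positivity
  refine (neg_le_abs X).trans (hX.trans ?_)
  have hK : 2 ≤ 8 / (2 - b) := by rw [le_div_iff₀ h2b]; linarith
  have hRRb : R ^ (-b) = (R ^ 2) ^ (-b / 2) := by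
    rw [← Real.rpow_natCast, ← Real.rpow_mul hR.le]; congr 1; push_cast; ring
  set A := |φ| with hA
  have hA0 : 0 ≤ A := abs_nonneg _
  have hA2 : φ ^ 2 = A ^ 2 := (sq_abs φ).symm
  rw [hA2]
  rcases le_total s (R ^ 2) with h | h
  · have hW : 0 < s ^ (-b / 2) := by positivity
    have h1 : s * s ^ (-b / 2) ≤ R ^ 2 * R ^ (-b) := by
      rw [hRRb]
      have : ∀ y : ℝ, 0 < y → y * y ^ (-b / 2) = y ^ (1 - b / 2) := fun y hy => by
        rw [← Real.rpow_one_add' hy.le (by linarith)]; congr 1; ring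
      rw [this s hs, this _ (by positivity)]
      exact Real.rpow_le_rpow hs.le h (by linarith)
    have h2 : 4 * A * G * √s ≤ (2 - b) / 2 * A ^ 2 + 8 / (2 - b) * (G ^ 2 * s) := by
      have hsq := Real.sq_sqrt hs.le
      have h3 : (2 - b) / 2 * A ^ 2 + 8 / (2 - b) * (G ^ 2 * s) - 4 * A * G * √s
          = ((2 - b) * A - 4 * G * √s) ^ 2 / (2 * (2 - b)) := by
        field_simp
        rw [show s = √s ^ 2 from hsq.symm, Real.sqrt_sq (Real.sqrt_nonneg s)]
        ring
      have : 0 ≤ ((2 - b) * A - 4 * G * √s) ^ 2 / (2 * (2 - b)) := by positivity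
      linarith
    calc 4 * A * G * (√s * s ^ (-b / 2)) = (4 * A * G * √s) * s ^ (-b / 2) := by ring
      _ ≤ ((2 - b) / 2 * A ^ 2 + 8 / (2 - b) * (G ^ 2 * s)) * s ^ (-b / 2) := by gcongr
      _ = (2 - b) / 2 * (A ^ 2 * s ^ (-b / 2)) + 8 / (2 - b) * ((s * s ^ (-b / 2)) * G ^ 2) := by ring
      _ ≤ _ := by
        gcongr
        have : 0 ≤ R ^ (-b) * A ^ 2 := by positivity
        have h5 : s * s ^ (-b / 2) * G ^ 2 ≤ R ^ 2 * R ^ (-b) * G ^ 2 := by gcongr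
        linarith
  · have h1 : √s * s ^ (-b / 2) ≤ R * R ^ (-b) := by
      have e1 : √s * s ^ (-b / 2) = s ^ ((1 - b) / 2) := by
        rw [Real.sqrt_eq_rpow, ← Real.rpow_add hs]; congr 1; ring
      have e2 : R * R ^ (-b) = (R ^ 2) ^ ((1 - b) / 2) := by
        rw [← Real.rpow_one_add' hR.le (by linarith), ← Real.rpow_natCast, ← Real.rpow_mul hR.le]
        congr 1; push_cast; ring
      rw [e1, e2]
      exact Real.rpow_le_rpow_of_nonpos (by positivity) h (by linarith)
    have h0 : 0 ≤ (2 - b) / 2 * (A ^ 2 * s ^ (-b / 2)) := by positivity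
    calc 4 * A * G * (√s * s ^ (-b / 2)) ≤ 4 * A * G * (R * R ^ (-b)) := by gcongr
      _ = R ^ (-b) * (4 * A * (G * R)) := by ring
      _ ≤ R ^ (-b) * (2 * (A ^ 2 + (G * R) ^ 2)) := by
        refine mul_le_mul_of_nonneg_left ?_ hRb.le
        nlinarith [sq_nonneg (A - G * R)]
      _ = 2 * (R ^ (-b) * A ^ 2 + R ^ 2 * R ^ (-b) * G ^ 2) := by ring
      _ ≤ 8 / (2 - b) * (R ^ (-b) * A ^ 2 + R ^ 2 * R ^ (-b) * G ^ 2) := by gcongr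
      _ ≤ _ := by linarith

theorem hasFDerivAt_V (b ε : ℝ) (hε : 0 < ε) (i : Fin 3) (x : Fin 3 → ℝ) :
    DifferentiableAt ℝ (fun x : Fin 3 → ℝ => x i * (x 0 ^ 2 + x 1 ^ 2 + ε) ^ (-b / 2)) x ∧
    ((i = 0 ∨ i = 1) → fderiv ℝ (fun x : Fin 3 → ℝ => x i * (x 0 ^ 2 + x 1 ^ 2 + ε) ^ (-b / 2)) x (Pi.single i 1)
      = (x 0 ^ 2 + x 1 ^ 2 + ε) ^ (-b / 2) -
        b * x i ^ 2 * (x 0 ^ 2 + x 1 ^ 2 + ε) ^ (-b / 2 - 1)) := by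
  have hs : x 0 ^ 2 + x 1 ^ 2 + ε ≠ 0 := by positivity
  have hp : ∀ j : Fin 3, HasFDerivAt (fun x : Fin 3 → ℝ => x j)
    (ContinuousLinearMap.proj (R := ℝ) (φ := fun _ : Fin 3 => ℝ) j) x := fun j => hasFDerivAt_apply j x
  have h := (hp i).mul (((((hp 0).pow 2).add ((hp 1).pow 2)).add_const ε).rpow_const (p := -b / 2) (Or.inl hs))
  refine ⟨h.differentiableAt, fun hi => ?_⟩
  erw [h.fderiv]
  rcases hi with rfl | rfl
  · simp
    ring
  · simp
    ring

theorem weightR_aux (b R ε : ℝ) (hb1 : 1 < b) (hb2 : b < 2) (hR : 0 < R) (hε : 0 < ε)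
    (f : (Fin 3 → ℝ) → ℝ) (hf : ContDiff ℝ 1 f) (hc : HasCompactSupport f) :
    (2 - b) / 2 * ∫ x, f x ^ 2 * (x 0 ^ 2 + x 1 ^ 2 + ε) ^ (-b / 2) ≤
      8 / (2 - b) * (R ^ (-b) * (∫ x, f x ^ 2) + R ^ 2 * R ^ (-b) * ∫ x, ‖fderiv ℝ f x‖ ^ 2) := by
  have hcf := hf.continuous
  have hcd : Continuous (fderiv ℝ f) := hf.continuous_fderiv (by norm_num)
  have hspos : ∀ x : Fin 3 → ℝ, 0 < x 0 ^ 2 + x 1 ^ 2 + ε := fun x => by positivity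
  have hcs : ∀ e : ℝ, Continuous (fun x : Fin 3 → ℝ => (x 0 ^ 2 + x 1 ^ 2 + ε) ^ e) := fun e =>
    Continuous.rpow_const (by fun_prop) (fun x => Or.inl (hspos x).ne')
  have hcW := hcs (-b / 2)
  have hcW1 := hcs (-b / 2 - 1)
  set V : Fin 3 → (Fin 3 → ℝ) → ℝ := fun i x => x i * (x 0 ^ 2 + x 1 ^ 2 + ε) ^ (-b / 2) with hV
  have hVc : ∀ i, Continuous (V i) := fun i => by fun_prop
  have key0 : ∀ F : (Fin 3 → ℝ) → ℝ, Continuous F → (∀ x, f x = 0 → F x = 0) → Integrable F := by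
    intro F hF h0
    refine hF.integrable_of_hasCompactSupport (hc.mono ?_)
    intro x hx hx'
    exact hx (h0 x hx')
  have ifd : Integrable (fun x => ‖fderiv ℝ f x‖ ^ 2) := by
    refine (hcd.norm.pow 2).integrable_of_hasCompactSupport ?_
    refine (hc.fderiv (𝕜 := ℝ)).mono ?_
    intro x hx hx'
    exact hx (by simp [hx'])
  have hdf2 : ∀ x v, fderiv ℝ (fun x => f x ^ 2) x v = 2 * f x * fderiv ℝ f x v := by
    intro x v
    have := ((hf.differentiable (by norm_num)) x).hasFDerivAt.pow 2
    erw [this.fderiv]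
    simp
  have ibp : ∀ i : Fin 3, (i = 0 ∨ i = 1) →
      ∫ x, f x ^ 2 * ((x 0 ^ 2 + x 1 ^ 2 + ε) ^ (-b / 2) -
        b * x i ^ 2 * (x 0 ^ 2 + x 1 ^ 2 + ε) ^ (-b / 2 - 1)) =
      - ∫ x, 2 * f x * fderiv ℝ f x (Pi.single i 1) * V i x := by
    intro i hi
    have hV' := fun x => (hasFDerivAt_V b ε hε i x).2 hi
    have := integral_mul_fderiv_eq_neg_fderiv_mul_of_integrable (μ := (volume : Measure (Fin 3 → ℝ)))
      (f := fun x => f x ^ 2) (g := V i) (v := Pi.single i 1) ?_ ?_ ?_ ?_ ?_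
    · simp only [hdf2] at this
      rw [← this]
      simp only [hV, hV']
    · simp only [hdf2]
      refine key0 _ ?_ ?_
      · have := hVc i; fun_prop
      · intro x hx; simp [hx]
    · simp only [hV, hV']
      refine key0 _ (by fun_prop) ?_
      intro x hx; simp [hx]
    · refine key0 _ ?_ ?_
      · have := hVc i; fun_prop
      · intro x hx; simp [hx]
    · intro x _
      exact (hf.differentiable (by norm_num) x).pow 2
    · intro x _
      exact (hasFDerivAt_V b ε hε i x).1
  have i1 : ∀ i : Fin 3, Integrable (fun x => f x ^ 2 * ((x 0 ^ 2 + x 1 ^ 2 + ε) ^ (-b / 2) -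
        b * x i ^ 2 * (x 0 ^ 2 + x 1 ^ 2 + ε) ^ (-b / 2 - 1))) := fun i =>
    key0 _ (by fun_prop) (by intro x hx; simp [hx])
  have i2 : ∀ i : Fin 3, Integrable (fun x => 2 * f x * fderiv ℝ f x (Pi.single i 1) * V i x) := fun i =>
    key0 _ (by have := hVc i; fun_prop) (by intro x hx; simp [hx])
  have i3 : Integrable (fun x => f x ^ 2 * (x 0 ^ 2 + x 1 ^ 2 + ε) ^ (-b / 2)) :=
    key0 _ (by fun_prop) (by intro x hx; simp [hx])
  have i4 : Integrable (fun x => f x ^ 2) := key0 _ (by fun_prop) (by intro x hx; simp [hx])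
  have step1 : (2 - b) * ∫ x, f x ^ 2 * (x 0 ^ 2 + x 1 ^ 2 + ε) ^ (-b / 2) ≤
      ∫ x, -(2 * f x * fderiv ℝ f x (Pi.single 0 1) * V 0 x + 2 * f x * fderiv ℝ f x (Pi.single 1 1) * V 1 x) := by
    rw [integral_neg, integral_add (i2 0) (i2 1), neg_add, ← ibp 0 (Or.inl rfl), ← ibp 1 (Or.inr rfl),
      ← integral_add (i1 0) (i1 1), ← integral_const_mul]
    refine integral_mono (i3.const_mul _) ((i1 0).add (i1 1)) fun x => ?_
    beta_reduce
    have hsx := hspos x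
    have e : (x 0 ^ 2 + x 1 ^ 2 + ε) ^ (-b / 2) = (x 0 ^ 2 + x 1 ^ 2 + ε) * (x 0 ^ 2 + x 1 ^ 2 + ε) ^ (-b / 2 - 1) := by
      rw [Real.rpow_sub_one hsx.ne']; field_simp
    have hpos : 0 < (x 0 ^ 2 + x 1 ^ 2 + ε) ^ (-b / 2 - 1) := by positivity
    rw [e]
    set w := (x 0 ^ 2 + x 1 ^ 2 + ε) ^ (-b / 2 - 1)
    have : 0 ≤ f x ^ 2 * (b * ε * w) := by positivity
    nlinarith
  have step2 : ∫ x, -(2 * f x * fderiv ℝ f x (Pi.single 0 1) * V 0 x + 2 * f x * fderiv ℝ f x (Pi.single 1 1) * V 1 x)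
     ≤ ∫ x, ((2 - b) / 2 * (f x ^ 2 * (x 0 ^ 2 + x 1 ^ 2 + ε) ^ (-b / 2)) +
      8 / (2 - b) * (R ^ (-b) * f x ^ 2 + R ^ 2 * R ^ (-b) * ‖fderiv ℝ f x‖ ^ 2)) := by
    refine integral_mono ((i2 0).add (i2 1)).neg ((i3.const_mul _).add
      (((i4.const_mul _).add (ifd.const_mul _)).const_mul _)) fun x => ?_
    refine pointwiseR b R _ (f x) _ _ hb1 hb2 hR (hspos x) (norm_nonneg _) ?_
    have hW : 0 < (x 0 ^ 2 + x 1 ^ 2 + ε) ^ (-b / 2) := Real.rpow_pos_of_pos (hspos x) _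
    have hVb : ∀ i : Fin 3, x i ^ 2 ≤ x 0 ^ 2 + x 1 ^ 2 + ε → |V i x| ≤
        √(x 0 ^ 2 + x 1 ^ 2 + ε) * (x 0 ^ 2 + x 1 ^ 2 + ε) ^ (-b / 2) := by
      intro i hi
      simp only [hV, abs_mul, abs_of_pos hW]
      gcongr
      exact Real.abs_le_sqrt hi
    have hdb : ∀ i : Fin 3, |fderiv ℝ f x (Pi.single i 1)| ≤ ‖fderiv ℝ f x‖ := by
      intro i
      have := (fderiv ℝ f x).le_opNorm (Pi.single i 1)
      rw [Pi.norm_single] at this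
      simpa using this
    have h0 := hVb 0 (by nlinarith [sq_nonneg (x 1)])
    have h1 := hVb 1 (by nlinarith [sq_nonneg (x 0)])
    refine (abs_add_le _ _).trans ?_
    have hh : ∀ i : Fin 3, |V i x| ≤
        √(x 0 ^ 2 + x 1 ^ 2 + ε) * (x 0 ^ 2 + x 1 ^ 2 + ε) ^ (-b / 2) →
        |2 * f x * fderiv ℝ f x (Pi.single i 1) * V i x| ≤ 2 * |f x| * ‖fderiv ℝ f x‖ *
        (√(x 0 ^ 2 + x 1 ^ 2 + ε) * (x 0 ^ 2 + x 1 ^ 2 + ε) ^ (-b / 2)) := by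
      intro i hi
      rw [abs_mul, abs_mul, abs_mul, abs_two]
      gcongr
      exact hdb i
    linarith [hh 0 h0, hh 1 h1]
  have i5 : Integrable (fun x => R ^ (-b) * f x ^ 2 + R ^ 2 * R ^ (-b) * ‖fderiv ℝ f x‖ ^ 2) :=
    (i4.const_mul _).add (ifd.const_mul _)
  rw [integral_add (i3.const_mul _) (i5.const_mul _),
    integral_const_mul, integral_const_mul, integral_add (i4.const_mul _) (ifd.const_mul _),
    integral_const_mul, integral_const_mul] at step2
  linarith

theorem weightR (b R : ℝ) (hb1 : 1 < b) (hb2 : b < 2) (hR : 0 < R)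
    (f : (Fin 3 → ℝ) → ℝ) (hf : ContDiff ℝ 1 f) (hc : HasCompactSupport f) :
    ∫⁻ x, ENNReal.ofReal (f x ^ 2) * ENNReal.ofReal ((x 0 ^ 2 + x 1 ^ 2) ^ (-b / 2)) ≤
      ENNReal.ofReal (16 / (2 - b) ^ 2 *
        (R ^ (-b) * (∫ x, f x ^ 2) + R ^ 2 * R ^ (-b) * ∫ x, ‖fderiv ℝ f x‖ ^ 2)) := by
  have hcf := hf.continuous
  set B := 16 / (2 - b) ^ 2 *
        (R ^ (-b) * (∫ x, f x ^ 2) + R ^ 2 * R ^ (-b) * ∫ x, ‖fderiv ℝ f x‖ ^ 2) with hB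
  have h2b : 0 < 2 - b := by linarith
  let ε : ℕ → ℝ := fun n => 1 / ((n : ℝ) + 1)
  have hε : ∀ n, 0 < ε n := fun n => by positivity
  have h1 : ∀ n, ∫⁻ x, ENNReal.ofReal (f x ^ 2 * (x 0 ^ 2 + x 1 ^ 2 + ε n) ^ (-b / 2)) ≤
      ENNReal.ofReal B := by
    intro n
    have hspos : ∀ x : Fin 3 → ℝ, 0 < x 0 ^ 2 + x 1 ^ 2 + ε n := fun x => by
      have := hε n; positivity
    have hcs : Continuous (fun x : Fin 3 → ℝ => (x 0 ^ 2 + x 1 ^ 2 + ε n) ^ (-b / 2)) :=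
      Continuous.rpow_const (by fun_prop) (fun x => Or.inl (hspos x).ne')
    have hi : Integrable (fun x => f x ^ 2 * (x 0 ^ 2 + x 1 ^ 2 + ε n) ^ (-b / 2)) := by
      refine Continuous.integrable_of_hasCompactSupport (by fun_prop) (hc.mono ?_)
      intro x hx hx'
      exact hx (by simp [hx'])
    rw [← ofReal_integral_eq_lintegral_ofReal hi]
    · apply ENNReal.ofReal_le_ofReal
      have := weightR_aux b R (ε n) hb1 hb2 hR (hε n) f hf hc
      rw [hB]
      set J := ∫ x, f x ^ 2 * (x 0 ^ 2 + x 1 ^ 2 + ε n) ^ (-b / 2)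
      set Y := R ^ (-b) * (∫ x, f x ^ 2) + R ^ 2 * R ^ (-b) * ∫ x, ‖fderiv ℝ f x‖ ^ 2
      calc J = 2 / (2 - b) * ((2 - b) / 2 * J) := by field_simp
        _ ≤ 2 / (2 - b) * (8 / (2 - b) * Y) := by gcongr
        _ = _ := by field_simp; ring
    · exact Filter.Eventually.of_forall fun x =>
        mul_nonneg (sq_nonneg _) (Real.rpow_nonneg (hspos x).le _)
  have h2 : ∀ x : Fin 3 → ℝ, ENNReal.ofReal (f x ^ 2) * ENNReal.ofReal ((x 0 ^ 2 + x 1 ^ 2) ^ (-b / 2)) ≤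
      Filter.liminf (fun n => ENNReal.ofReal (f x ^ 2 * (x 0 ^ 2 + x 1 ^ 2 + ε n) ^ (-b / 2))) Filter.atTop := by
    intro x
    by_cases h0 : x 0 ^ 2 + x 1 ^ 2 = 0
    · rw [h0, Real.zero_rpow (by linarith)]; simp
    · have ht : Filter.Tendsto (fun n => ENNReal.ofReal (f x ^ 2 * (x 0 ^ 2 + x 1 ^ 2 + ε n) ^ (-b / 2)))
          Filter.atTop (nhds (ENNReal.ofReal (f x ^ 2 * (x 0 ^ 2 + x 1 ^ 2) ^ (-b / 2)))) := by
        refine ENNReal.tendsto_ofReal (Filter.Tendsto.const_mul _ ?_)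
        have : Filter.Tendsto (fun n => x 0 ^ 2 + x 1 ^ 2 + ε n) Filter.atTop (nhds (x 0 ^ 2 + x 1 ^ 2)) := by
          simpa [ε] using (tendsto_one_div_add_atTop_nhds_zero_nat (𝕜 := ℝ)).const_add (x 0 ^ 2 + x 1 ^ 2)
        exact this.rpow_const (Or.inl h0)
      rw [ht.liminf_eq, ENNReal.ofReal_mul (sq_nonneg _)]
  calc _ ≤ _ := lintegral_mono h2
    _ ≤ _ := lintegral_liminf_le (fun n => by fun_prop)
    _ ≤ ENNReal.ofReal B := by
      refine (Filter.liminf_le_liminf (Filter.Eventually.of_forall h1)).trans ?_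
      simp

theorem cs_ineq {E F : Type*} [NormedAddCommGroup E] [NormedAddCommGroup F]
    (u : (Fin 3 → ℝ) → E) (v : (Fin 3 → ℝ) → F) (hu : Continuous u) (hv : Continuous v)
    (hcu : HasCompactSupport u) (hcv : HasCompactSupport v) :
    ∫ x, ‖u x‖ * ‖v x‖ ≤ √(∫ x, ‖u x‖ ^ 2) * √(∫ x, ‖v x‖ ^ 2) := by
  have h := integral_mul_le_Lp_mul_Lq_of_nonneg (μ := (volume : Measure (Fin 3 → ℝ)))
    Real.HolderConjugate.two_two
    (f := fun x => ‖u x‖) (g := fun x => ‖v x‖)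
    (Filter.Eventually.of_forall fun x => norm_nonneg _)
    (Filter.Eventually.of_forall fun x => norm_nonneg _)
    (hu.norm.memLp_of_hasCompactSupport hcu.norm) (hv.norm.memLp_of_hasCompactSupport hcv.norm)
  simpa [Real.sqrt_eq_rpow] using h

theorem weight3' (a R A B : ℝ) (ha0 : 0 < a) (ha : a < 1) (hR : 0 < R) (u : (Fin 3 → ℝ) → ℝ)
    (hu : ContDiff ℝ 1 u) (hc : HasCompactSupport u) (hA : ∫ x, ‖fderiv ℝ u x‖ ≤ A)
    (hB : ∫ x, |u x| ≤ B) :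
    ∫⁻ x, ENNReal.ofReal |u x| * ENNReal.ofReal (|x 2| ^ (-a)) ≤
      ENNReal.ofReal (2 / (1 - a) * R ^ (1 - a) * A + R ^ (-a) * B) := by
  have h := weight3 a R ha0 ha hR u hu hc
  have hcu := hu.continuous
  have hcd : Continuous (fderiv ℝ u) := hu.continuous_fderiv (by norm_num)
  have i1 : Integrable u := hcu.integrable_of_hasCompactSupport hc
  have i2 : Integrable (fderiv ℝ u) := hcd.integrable_of_hasCompactSupport (hc.fderiv (𝕜 := ℝ))
  rw [← ofReal_integral_norm_eq_lintegral_enorm i1, ← ofReal_integral_norm_eq_lintegral_enorm i2] at h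
  have ha' : 0 < 1 - a := by linarith
  have hA0 : 0 ≤ A := le_trans (integral_nonneg fun x => norm_nonneg _) hA
  have hB0 : 0 ≤ B := le_trans (integral_nonneg fun x => abs_nonneg _) hB
  have e : ∀ x, ENNReal.ofReal |u x| = ‖u x‖ₑ := fun x => by
    rw [← ofReal_norm, Real.norm_eq_abs]
  simp only [e]
  refine h.trans ?_
  rw [ENNReal.ofReal_add (by positivity) (by positivity), ENNReal.ofReal_mul (p := 2 / (1 - a) * R ^ (1 - a)) (by positivity),
    ENNReal.ofReal_mul (p := R ^ (-a)) (by positivity)]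
  gcongr
  exact hB

theorem est2
    (f : (Fin 3 → ℝ) → ℝ) (hf : ContDiff ℝ 1 f) (hc : HasCompactSupport f)
    (n d : ℝ) (hn : 0 < n) (hd : 0 < d)
    (hS : ∫ x, f x ^ 2 = n ^ 2) (hT : ∫ x, ‖fderiv ℝ f x‖ ^ 2 = d ^ 2)
    (a : ℝ) (ha0 : 0 < a) (ha : a < 1) :
    ∫⁻ x, ENNReal.ofReal (f x ^ 2) * ENNReal.ofReal (|x 2| ^ (-a)) ≤
      ENNReal.ofReal ((4 / (1 - a) + 1) * (n ^ (2 - a) * d ^ a)) := by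
  have hcf := hf.continuous
  have hcd : Continuous (fderiv ℝ f) := hf.continuous_fderiv (by norm_num)
  have hR : 0 < n / d := by positivity
  have ha' : 0 < 1 - a := by linarith
  have h1 := cs_ineq f (fderiv ℝ f) hcf hcd hc (hc.fderiv (𝕜 := ℝ))
  simp only [Real.norm_eq_abs (f _), sq_abs] at h1
  rw [hS, hT, Real.sqrt_sq hn.le, Real.sqrt_sq hd.le] at h1
  have hdf2 : ∀ x, ‖fderiv ℝ (fun x => f x ^ 2) x‖ = 2 * (|f x| * ‖fderiv ℝ f x‖) := by
    intro x
    have := ((hf.differentiable (by norm_num)) x).hasFDerivAt.pow 2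
    erw [this.fderiv]
    simp [norm_smul]
    ring
  have h := weight3' a (n / d) (2 * (n * d)) (n ^ 2) ha0 ha hR (fun x => f x ^ 2) (hf.pow 2)
    (hc.comp_left (g := fun y : ℝ => y ^ 2) (by simp)) ?_ ?_
  · simp only [abs_pow, sq_abs] at h
    refine h.trans (le_of_eq ?_)
    congr 1
    rw [Real.div_rpow hn.le hd.le, Real.div_rpow hn.le hd.le, Real.rpow_sub hn, Real.rpow_sub hd,
      Real.rpow_sub hn, Real.rpow_neg hn.le, Real.rpow_neg hd.le, Real.rpow_one, Real.rpow_one, Real.rpow_two]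
    have := Real.rpow_pos_of_pos hn a
    have := Real.rpow_pos_of_pos hd a
    field_simp
    ring
  · simp only [hdf2]
    rw [integral_const_mul]
    linarith
  · simp only [abs_pow, sq_abs]
    exact hS.le

theorem estR
    (f : (Fin 3 → ℝ) → ℝ) (hf : ContDiff ℝ 1 f) (hc : HasCompactSupport f)
    (n d : ℝ) (hn : 0 < n) (hd : 0 < d)
    (hS : ∫ x, f x ^ 2 = n ^ 2) (hT : ∫ x, ‖fderiv ℝ f x‖ ^ 2 = d ^ 2)
    (b : ℝ) (hb1 : 1 < b) (hb2 : b < 2) :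
    ∫⁻ x, ENNReal.ofReal (f x ^ 2) * ENNReal.ofReal ((x 0 ^ 2 + x 1 ^ 2) ^ (-b / 2)) ≤
      ENNReal.ofReal (32 / (2 - b) ^ 2 * (n ^ (2 - b) * d ^ b)) := by
  have hR : 0 < n / d := by positivity
  refine (weightR b (n / d) hb1 hb2 hR f hf hc).trans (le_of_eq ?_)
  congr 1
  rw [hS, hT, Real.div_rpow hn.le hd.le, 
      Real.rpow_sub hn, Real.rpow_neg hn.le, Real.rpow_neg hd.le, Real.rpow_two]
  have := Real.rpow_pos_of_pos hn b
  have := Real.rpow_pos_of_pos hd b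
  have h2b : 2 - b ≠ 0 := by linarith
  field_simp
  ring

theorem est4
    (f : (Fin 3 → ℝ) → ℝ) (hf : ContDiff ℝ 1 f) (hc : HasCompactSupport f)
    (n d K : ℝ) (hn : 0 < n) (hd : 0 < d) (hK : 0 ≤ K)
    (hS : ∫ x, f x ^ 2 = n ^ 2) (hT : ∫ x, ‖fderiv ℝ f x‖ ^ 2 = d ^ 2)
    (h6 : ∫ x, f x ^ 6 ≤ (K * d) ^ 6)
    (a : ℝ) (ha0 : 0 < a) (ha : a < 1) :
    ∫⁻ x, ENNReal.ofReal (f x ^ 4) * ENNReal.ofReal (|x 2| ^ (-a)) ≤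
      ENNReal.ofReal (K ^ 3 * (8 / (1 - a) + 1) * (n ^ (1 - a) * d ^ (3 + a))) := by
  have hcf := hf.continuous
  have hcd : Continuous (fderiv ℝ f) := hf.continuous_fderiv (by norm_num)
  have hR : 0 < n / d := by positivity
  have ha' : 0 < 1 - a := by linarith
  have hKd : 0 ≤ K * d := by positivity
  have h6' : √(∫ x, f x ^ 6) ≤ (K * d) ^ 3 := by
    rw [Real.sqrt_le_left (by positivity)]
    refine h6.trans (le_of_eq (by ring))
  have hc3 : HasCompactSupport (fun x => f x ^ 3) := hc.comp_left (g := fun y : ℝ => y ^ 3) (by simp)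
  have h1 := cs_ineq (fun x => f x ^ 3) (fderiv ℝ f) (by fun_prop) hcd hc3 (hc.fderiv (𝕜 := ℝ))
  have h2 := cs_ineq f (fun x => f x ^ 3) (by fun_prop) (by fun_prop) hc hc3
  have e6 : ∀ x, ‖f x ^ 3‖ ^ 2 = f x ^ 6 := fun x => by
    rw [Real.norm_eq_abs, sq_abs]; ring
  have e2 : ∀ x, ‖f x‖ ^ 2 = f x ^ 2 := fun x => by
    rw [Real.norm_eq_abs, sq_abs]
  have e4 : ∀ x, ‖f x‖ * ‖f x ^ 3‖ = |f x ^ 4| := fun x => by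
    rw [Real.norm_eq_abs, Real.norm_eq_abs, ← abs_mul]; congr 1; ring
  simp only [e6, e2, e4] at h1 h2
  rw [hT, Real.sqrt_sq hd.le] at h1
  rw [hS, Real.sqrt_sq hn.le] at h2
  have hdf2 : ∀ x, ‖fderiv ℝ (fun x => f x ^ 4) x‖ = 4 * (‖f x ^ 3‖ * ‖fderiv ℝ f x‖) := by
    intro x
    have := ((hf.differentiable (by norm_num)) x).hasFDerivAt.pow 4
    erw [this.fderiv]
    simp [norm_smul]
    ring
  have h := weight3' a (n / d) (4 * ((K * d) ^ 3 * d)) (n * (K * d) ^ 3) ha0 ha hR (fun x => f x ^ 4) (hf.pow 4)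
    (hc.comp_left (g := fun y : ℝ => y ^ 4) (by simp)) ?_ ?_
  · have e : ∀ x, |f x ^ 4| = f x ^ 4 := fun x => abs_of_nonneg (by positivity)
    simp only [e] at h
    refine h.trans (le_of_eq ?_)
    congr 1
    rw [Real.div_rpow hn.le hd.le, Real.div_rpow hn.le hd.le, Real.rpow_sub hn, Real.rpow_sub hd,
      Real.rpow_neg hn.le, Real.rpow_neg hd.le, Real.rpow_one, Real.rpow_one, Real.rpow_add hd]
    have := Real.rpow_pos_of_pos hn a
    have := Real.rpow_pos_of_pos hd a
    norm_cast
    field_simp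
    ring
  · simp only [hdf2]
    rw [integral_const_mul]
    gcongr
    exact h1.trans (by gcongr)
  · exact h2.trans (by gcongr)

theorem est6
    (f : (Fin 3 → ℝ) → ℝ) (hf : ContDiff ℝ 1 f) (hc : HasCompactSupport f)
    (d K : ℝ) (h6 : ∫ x, f x ^ 6 ≤ (K * d) ^ 6) :
    ∫⁻ x, ENNReal.ofReal (f x ^ 6) ≤ ENNReal.ofReal (K ^ 6 * d ^ (6 : ℝ)) := by
  have hcf := hf.continuous
  have hi : Integrable (fun x => f x ^ 6) :=
    Continuous.integrable_of_hasCompactSupport (by fun_prop) (hc.comp_left (g := fun y : ℝ => y ^ 6) (by simp))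
  rw [← ofReal_integral_eq_lintegral_ofReal hi (Filter.Eventually.of_forall fun x => by positivity)]
  apply ENNReal.ofReal_le_ofReal
  refine h6.trans (le_of_eq ?_)
  rw [mul_pow]; norm_cast

theorem pointwise_holder (α q a b t₁ t₁' t₂ t₃ φ y s : ℝ) (hα0 : 0 < α) (hq : 0 < q)
    (hs : 0 ≤ s)
    (ht : 4 * t₁ + 2 * t₁' + 2 * t₂ + 6 * t₃ = q) (ha : a * (t₁ + t₁') = α * q / 2)
    (hb : b * t₂ = q / 2) :
    |φ / (|y| ^ (α / 2) * s ^ ((1 : ℝ) / 4))| ^ q ≤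
      (φ ^ 4 * |y| ^ (-a)) ^ t₁ * (φ ^ 2 * |y| ^ (-a)) ^ t₁' * (φ ^ 2 * s ^ (-b / 2)) ^ t₂ *
        (φ ^ 6) ^ t₃ := by
  by_cases h0 : φ = 0 ∨ y = 0 ∨ s = 0
  · have : |φ / (|y| ^ (α / 2) * s ^ ((1 : ℝ) / 4))| ^ q = 0 := by
      have h1 : α / 2 ≠ 0 := by positivity
      rcases h0 with rfl | rfl | rfl
      · simp [Real.zero_rpow hq.ne']
      · simp [Real.zero_rpow hq.ne', Real.zero_rpow h1]
      · simp [Real.zero_rpow hq.ne']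
    rw [this]
    positivity
  · push Not at h0
    obtain ⟨h1, h2, h3⟩ := h0
    have hs' : 0 < s := lt_of_le_of_ne hs (Ne.symm h3)
    have e4 : φ ^ 4 = |φ| ^ 4 := by rw [← abs_pow, abs_of_nonneg]; positivity
    have e2 : φ ^ 2 = |φ| ^ 2 := by rw [sq_abs]
    have e6 : φ ^ 6 = |φ| ^ 6 := by rw [← abs_pow, abs_of_nonneg]; positivity
    have hd : 0 ≤ |y| ^ (α / 2) * s ^ ((1 : ℝ) / 4) := by positivity
    rw [e4, e2, e6, abs_div, abs_of_nonneg hd]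
    rw [← Real.exp_log (abs_pos.2 h1), ← Real.exp_log (abs_pos.2 h2), ← Real.exp_log hs']
    generalize Real.log |φ| = u
    generalize Real.log |y| = v
    generalize Real.log s = w
    simp only [← Real.exp_mul, ← Real.exp_add, ← Real.exp_sub, ← Real.exp_nat_mul]
    apply le_of_eq
    congr 1
    push_cast
    linear_combination (-u) * ht + v * ha + w / 2 * hb

set_option maxHeartbeats 1000000 in
theorem key (α q K : ℝ) (hα0 : 0 < α) (hα : α < 1 / 4) (hq2 : 2 < q)
    (hq : q * (1 + α / 2) < 3) (hK : 0 < K) :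
    ∃ C : ℝ, 0 < C ∧ ∀ (f : (Fin 3 → ℝ) → ℝ) (_ : ContDiff ℝ 1 f) (_ : HasCompactSupport f)
      (n d : ℝ) (_ : 0 < n) (_ : 0 < d)
      (_ : ∫ x, f x ^ 2 = n ^ 2) (_ : ∫ x, ‖fderiv ℝ f x‖ ^ 2 = d ^ 2)
      (_ : ∫ x, f x ^ 6 ≤ (K * d) ^ 6),
      ∫⁻ x, ‖f x / (|x 2| ^ (α / 2) * (x 0 ^ 2 + x 1 ^ 2) ^ ((1 : ℝ) / 4))‖ₑ ^ q ≤
        ENNReal.ofReal (C * (n ^ (3 - q - α * q / 2) * d ^ (2 * q - 3 + α * q / 2))) := by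
  obtain ⟨t₁, t₁', t₂, t₃, h1, h1', h2, h3, hsum, hq', hs1, hs2⟩ :=
    exists_params α q hα0 hα hq2 hq
  have hq0 : 0 < q := by linarith
  have hsp : 0 < t₁ + t₁' := lt_trans (by positivity) hs1
  have h2p : 0 < t₂ := lt_trans (by positivity) hs2
  obtain ⟨a, haE⟩ : ∃ a, a = α * q / 2 / (t₁ + t₁') := ⟨_, rfl⟩
  obtain ⟨b, hbE⟩ : ∃ b, b = q / 2 / t₂ := ⟨_, rfl⟩
  have ha : a * (t₁ + t₁') = α * q / 2 := by rw [haE]; field_simp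
  have hb : b * t₂ = q / 2 := by rw [hbE]; field_simp
  have ha0 : 0 < a := by rw [haE]; positivity
  have ha1 : a < 1 := by rw [haE, div_lt_one hsp]; exact hs1
  have hb1 : 1 < b := by rw [hbE, lt_div_iff₀ h2p]; linarith
  have hb2 : b < 2 := by rw [hbE, div_lt_iff₀ h2p]; linarith
  have ha' : 0 < 1 - a := by linarith
  have hb' : 0 < 2 - b := by linarith
  obtain ⟨C1, hC1⟩ : ∃ c, c = K ^ 3 * (8 / (1 - a) + 1) := ⟨_, rfl⟩
  obtain ⟨C1', hC1'⟩ : ∃ c, c = 4 / (1 - a) + 1 := ⟨_, rfl⟩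
  obtain ⟨C2, hC2⟩ : ∃ c, c = 32 / (2 - b) ^ 2 := ⟨_, rfl⟩
  obtain ⟨C3, hC3⟩ : ∃ c, c = K ^ 6 := ⟨_, rfl⟩
  have p1 : 0 < C1 := by rw [hC1]; positivity
  have p1' : 0 < C1' := by rw [hC1']; positivity
  have p2 : 0 < C2 := by rw [hC2]; positivity
  have p3 : 0 < C3 := by rw [hC3]; positivity
  refine ⟨C1 ^ t₁ * C1' ^ t₁' * C2 ^ t₂ * C3 ^ t₃, by positivity, ?_⟩
  intro f hf hc n d hn hd hS hT h6
  have hcf := hf.continuous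
  have b1 := est4 f hf hc n d K hn hd hK.le hS hT h6 a ha0 ha1
  have b1' := est2 f hf hc n d hn hd hS hT a ha0 ha1
  have b2 := estR f hf hc n d hn hd hS hT b hb1 hb2
  have b3 := est6 f hf hc d K h6
  rw [← hC1] at b1
  rw [← hC1'] at b1'
  rw [← hC2] at b2
  rw [← hC3] at b3
  have g0 : Measurable (fun x : Fin 3 → ℝ => ENNReal.ofReal (f x ^ 4) * ENNReal.ofReal (|x 2| ^ (-a))) := by
    fun_prop
  have g1 : Measurable (fun x : Fin 3 → ℝ => ENNReal.ofReal (f x ^ 2) * ENNReal.ofReal (|x 2| ^ (-a))) := by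
    fun_prop
  have g2 : Measurable (fun x : Fin 3 → ℝ =>
      ENNReal.ofReal (f x ^ 2) * ENNReal.ofReal ((x 0 ^ 2 + x 1 ^ 2) ^ (-b / 2))) := by
    fun_prop
  have g3 : Measurable (fun x : Fin 3 → ℝ => ENNReal.ofReal (f x ^ 6)) := by
    fun_prop
  let G : Fin 4 → (Fin 3 → ℝ) → ℝ≥0∞ :=
    ![fun x => ENNReal.ofReal (f x ^ 4) * ENNReal.ofReal (|x 2| ^ (-a)),
      fun x => ENNReal.ofReal (f x ^ 2) * ENNReal.ofReal (|x 2| ^ (-a)),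
      fun x => ENNReal.ofReal (f x ^ 2) * ENNReal.ofReal ((x 0 ^ 2 + x 1 ^ 2) ^ (-b / 2)),
      fun x => ENNReal.ofReal (f x ^ 6)]
  let t : Fin 4 → ℝ := ![t₁, t₁', t₂, t₃]
  have hol := ENNReal.lintegral_prod_norm_pow_le (μ := (volume : Measure (Fin 3 → ℝ)))
    Finset.univ (f := G) (p := t) ?_ ?_ ?_
  rotate_left
  · intro i _
    fin_cases i
    exacts [g0.aemeasurable, g1.aemeasurable, g2.aemeasurable, g3.aemeasurable]
  · simp [Fin.sum_univ_four, t, hsum]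
  · intro i _
    fin_cases i <;> simp [t, h1, h1', h2, h3]
  simp only [Fin.prod_univ_four, G, t, Matrix.cons_val] at hol
  calc _ ≤ _ := lintegral_mono fun x => ?_
    _ ≤ _ := hol
    _ ≤ ENNReal.ofReal (C1 * (n ^ (1 - a) * d ^ (3 + a))) ^ t₁ *
        ENNReal.ofReal (C1' * (n ^ (2 - a) * d ^ a)) ^ t₁' *
        ENNReal.ofReal (C2 * (n ^ (2 - b) * d ^ b)) ^ t₂ *
        ENNReal.ofReal (C3 * d ^ (6 : ℝ)) ^ t₃ := by gcongr
    _ = _ := ?_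
  · have hs : 0 ≤ x 0 ^ 2 + x 1 ^ 2 := by positivity
    have := pointwise_holder α q a b t₁ t₁' t₂ t₃ (f x) (x 2) (x 0 ^ 2 + x 1 ^ 2) hα0 hq0 hs
      (by linarith) ha hb
    rw [← ENNReal.ofReal_mul (by positivity), ← ENNReal.ofReal_mul (by positivity),
      ← ENNReal.ofReal_mul (by positivity), ENNReal.ofReal_rpow_of_nonneg (by positivity) h1,
      ENNReal.ofReal_rpow_of_nonneg (by positivity) h1', ENNReal.ofReal_rpow_of_nonneg (by positivity) h2,
      ENNReal.ofReal_rpow_of_nonneg (by positivity) h3,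
      ← ENNReal.ofReal_mul (by positivity), ← ENNReal.ofReal_mul (by positivity),
      ← ENNReal.ofReal_mul (by positivity), ← ofReal_norm, Real.norm_eq_abs,
      ENNReal.ofReal_rpow_of_nonneg (by positivity) hq0.le]
    exact ENNReal.ofReal_le_ofReal this
  · rw [ENNReal.ofReal_rpow_of_nonneg (by positivity) h1,
      ENNReal.ofReal_rpow_of_nonneg (by positivity) h1', ENNReal.ofReal_rpow_of_nonneg (by positivity) h2,
      ENNReal.ofReal_rpow_of_nonneg (by positivity) h3,
      ← ENNReal.ofReal_mul (by positivity), ← ENNReal.ofReal_mul (by positivity),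
      ← ENNReal.ofReal_mul (by positivity)]
    congr 1
    rw [← Real.exp_log hn, ← Real.exp_log hd, ← Real.exp_log p1, ← Real.exp_log p1', ← Real.exp_log p2,
      ← Real.exp_log p3]
    simp only [← Real.exp_mul, ← Real.exp_add]
    congr 1
    have E1 : t₁ * (1 - a) + t₁' * (2 - a) + t₂ * (2 - b) = 3 - q - α * q / 2 := by
      linear_combination (-1) * ha - hb + 2 * hsum - hq' / 2
    have E2 : t₁ * (3 + a) + t₁' * a + t₂ * b + 6 * t₃ = 2 * q - 3 + α * q / 2 := by
      linear_combination ha + hb + 3 / 2 * hq'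
    linear_combination Real.log n * E1 + Real.log d * E2

/-- **Hardy–Sobolev + Gagliardo–Nirenberg estimate with the weight `|x_3|^{-α/2} r^{-1/2}`.**
For `0 < α < 1/4` and `3/(1−α) < p < ∞`, with `r = √(x_1²+x_2²)`, one has, for all
`f ∈ C_0^∞(ℝ³)`,
`‖ f/(|x_3|^{α/2} r^{1/2}) ‖_{L^{2p/(p−1)}(ℝ³)}
  ≤ C ‖f‖_{L²}^{(p−3−pα)/(2p)} ‖∇f‖_{L²}^{(p+3+pα)/(2p)}`. -/
theorem hardy_sobolev_GN_mixed_weight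
    (α p : ℝ) (hα0 : 0 < α) (hα : α < 1 / 4) (hp : 3 / (1 - α) < p) :
    ∃ C : ℝ, 0 < C ∧ ∀ f : (Fin 3 → ℝ) → ℝ,
      ContDiff ℝ (⊤ : ℕ∞) f → HasCompactSupport f →
      eLpNorm (fun x => f x / (|x 2| ^ (α / 2) * (x 0 ^ 2 + x 1 ^ 2) ^ ((1 : ℝ) / 4)))
          (ENNReal.ofReal (2 * p / (p - 1))) volume
        ≤ ENNReal.ofReal C *
          (eLpNorm f 2 volume ^ ((p - 3 - p * α) / (2 * p)) *
            eLpNorm (fderiv ℝ f) 2 volume ^ ((p + 3 + p * α) / (2 * p))) := by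
  rw [div_lt_iff₀ (by linarith)] at hp
  have hp3 : 3 < p := by nlinarith
  have hp1 : 0 < p - 1 := by linarith
  obtain ⟨q, hqE⟩ : ∃ q, q = 2 * p / (p - 1) := ⟨_, rfl⟩
  rw [← hqE]
  have hq2 : 2 < q := by rw [hqE, lt_div_iff₀ hp1]; linarith
  have hq : q * (1 + α / 2) < 3 := by
    rw [hqE, div_mul_eq_mul_div, div_lt_iff₀ hp1]; nlinarith
  have hq0 : 0 < q := by linarith
  obtain ⟨K0, hK0⟩ : ∃ K0 : NNReal, K0 = SNormLESNormFDerivOfEqConst ℝ (volume : Measure (Fin 3 → ℝ)) (2 : NNReal) :=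
    ⟨_, rfl⟩
  have hKp : 0 < (K0 : ℝ) + 1 := by positivity
  obtain ⟨C, hC, H⟩ := key α q (K0 + 1) hα0 hα hq2 hq hKp
  refine ⟨C ^ (1 / q), by positivity, fun f hf hc => ?_⟩
  have hf1 : ContDiff ℝ 1 f := hf.of_le (by exact_mod_cast le_top)
  have hcf := hf1.continuous
  have hcd : Continuous (fderiv ℝ f) := hf1.continuous_fderiv (by norm_num)
  have sob : eLpNorm f 6 volume ≤ K0 * eLpNorm (fderiv ℝ f) 2 volume := by
    have := eLpNorm_le_eLpNorm_fderiv_of_eq (volume : Measure (Fin 3 → ℝ)) hf1 hc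
      (p := 2) (p' := 6) (by norm_num) (by simp) (by simp; norm_num)
    rw [hK0]
    exact_mod_cast this
  have hzero : f =ᵐ[volume] 0 → eLpNorm (fun x => f x / (|x 2| ^ (α / 2) * (x 0 ^ 2 + x 1 ^ 2) ^ ((1 : ℝ) / 4)))
          (ENNReal.ofReal q) volume = 0 := by
    intro h
    rw [← eLpNorm_zero (p := ENNReal.ofReal q) (μ := (volume : Measure (Fin 3 → ℝ))) (ε := ℝ)]
    refine eLpNorm_congr_ae ?_
    filter_upwards [h] with x hx
    simp [hx]
  have m2 : MemLp f 2 volume := hcf.memLp_of_hasCompactSupport hc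
  have m6 : MemLp f 6 volume := hcf.memLp_of_hasCompactSupport hc
  have md : MemLp (fderiv ℝ f) 2 volume := hcd.memLp_of_hasCompactSupport (hc.fderiv (𝕜 := ℝ))
  by_cases hN : eLpNorm f 2 volume = 0
  · rw [eLpNorm_eq_zero_iff m2.1 (by norm_num)] at hN
    rw [hzero hN]; exact zero_le
  by_cases hD : eLpNorm (fderiv ℝ f) 2 volume = 0
  · rw [hD, mul_zero, nonpos_iff_eq_zero, eLpNorm_eq_zero_iff m2.1 (by norm_num)] at sob
    rw [hzero sob]; exact zero_le
  have eN := m2.eLpNorm_eq_integral_rpow_norm (by norm_num) (by norm_num)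
  have eD := md.eLpNorm_eq_integral_rpow_norm (by norm_num) (by norm_num)
  have e6 := m6.eLpNorm_eq_integral_rpow_norm (by norm_num) (by norm_num)
  obtain ⟨n, hnE⟩ : ∃ n, n = (∫ x, ‖f x‖ ^ (2 : ℝ≥0∞).toReal) ^ (2 : ℝ≥0∞).toReal⁻¹ := ⟨_, rfl⟩
  obtain ⟨d, hdE⟩ : ∃ n, n = (∫ x, ‖fderiv ℝ f x‖ ^ (2 : ℝ≥0∞).toReal) ^ (2 : ℝ≥0∞).toReal⁻¹ := ⟨_, rfl⟩
  rw [← hnE] at eN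
  rw [← hdE] at eD
  have hn : 0 < n := by
    by_contra! h
    exact hN (by rw [eN, ENNReal.ofReal_of_nonpos h])
  have hd : 0 < d := by
    by_contra! h
    exact hD (by rw [eD, ENNReal.ofReal_of_nonpos h])
  have hS : ∫ x, f x ^ 2 = n ^ 2 := by
    have h0 : 0 ≤ ∫ x, f x ^ 2 := integral_nonneg fun x => sq_nonneg _
    simp only [ENNReal.toReal_ofNat, Real.rpow_ofNat, Real.norm_eq_abs, sq_abs] at hnE
    rw [hnE, ← Real.rpow_natCast, ← Real.rpow_mul h0]; norm_num
  have hT : ∫ x, ‖fderiv ℝ f x‖ ^ 2 = d ^ 2 := by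
    have h0 : 0 ≤ ∫ x, ‖fderiv ℝ f x‖ ^ 2 := integral_nonneg fun x => sq_nonneg _
    simp only [ENNReal.toReal_ofNat, Real.rpow_ofNat] at hdE
    rw [hdE, ← Real.rpow_natCast, ← Real.rpow_mul h0]; norm_num
  have h6 : ∫ x, f x ^ 6 ≤ (((K0 : ℝ) + 1) * d) ^ 6 := by
    have e : ∀ x, |f x| ^ 6 = f x ^ 6 := fun x => by rw [← abs_pow, abs_of_nonneg]; positivity
    have h0 : 0 ≤ ∫ x, f x ^ 6 := integral_nonneg fun x => by positivity
    simp only [ENNReal.toReal_ofNat, Real.rpow_ofNat, Real.norm_eq_abs, e] at e6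
    rw [e6, eD, ← ENNReal.ofReal_coe_nnreal, ← ENNReal.ofReal_mul (by positivity),
      ENNReal.ofReal_le_ofReal_iff (by positivity)] at sob
    have hle : (∫ x, f x ^ 6) ^ (6 : ℝ)⁻¹ ≤ ((K0 : ℝ) + 1) * d := sob.trans (by gcongr; linarith)
    calc ∫ x, f x ^ 6 = ((∫ x, f x ^ 6) ^ (6 : ℝ)⁻¹) ^ 6 := by
          rw [← Real.rpow_natCast, ← Real.rpow_mul h0]; norm_num
      _ ≤ _ := by gcongr
  have main := H f hf1 hc n d hn hd hS hT h6
  rw [eN, eD, eLpNorm_eq_lintegral_rpow_enorm_toReal (by simpa using hq0) (by simp),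
    ENNReal.toReal_ofReal hq0.le]
  calc _ ≤ _ := ENNReal.rpow_le_rpow main (by positivity)
    _ = _ := by
      rw [ENNReal.ofReal_rpow_of_pos hn, ENNReal.ofReal_rpow_of_pos hd, ← ENNReal.ofReal_mul (by positivity),
        ← ENNReal.ofReal_mul (by positivity), ENNReal.ofReal_rpow_of_nonneg (by positivity) (by positivity)]
      congr 1
      rw [Real.mul_rpow (by positivity) (by positivity), Real.mul_rpow (by positivity) (by positivity),
        ← Real.rpow_mul hn.le, ← Real.rpow_mul hd.le]
      have hp0 : p ≠ 0 := by linarith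
      have hp1' : p - 1 ≠ 0 := hp1.ne'
      congr 3
      · rw [hqE]; field_simp; ring
      · rw [hqE]; field_simp; ring
end

section
/- Let 0 ≤ α < 1/4. Then there exists a constant C>0 such that for all f ∈ C_0^∞(ℝ³), ‖ f / |x_3|^{α} ‖_{L^{6/(1+2α)}(ℝ³)} ≤ C ‖ ∇f ‖_{L^2(ℝ³)}. -/
open MeasureTheory ENNReal Real

noncomputable def hsPsi (β : ℝ) (s : ℝ) : ℝ := if |s| ≤ 1 then |s| ^ (-β) else |s| ^ (-3 : ℝ)

lemma hsPsi_nonneg (β s : ℝ) : 0 ≤ hsPsi β s := by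
  unfold hsPsi; split_ifs <;> positivity

lemma hsPsi_meas (β : ℝ) : Measurable (hsPsi β) := by
  unfold hsPsi
  refine Measurable.ite (measurableSet_le (by fun_prop) (by fun_prop)) (by fun_prop) (by fun_prop)

lemma hsPsi_lt_top (β : ℝ) (hβ : β < 1) : ∫⁻ s, ENNReal.ofReal (hsPsi β s) < ⊤ := by
  have h1 : Integrable (Set.indicator (Set.Ioc (0:ℝ) 1) (fun t => t ^ (-β))) := by
    rw [integrable_indicator_iff measurableSet_Ioc]
    have := intervalIntegral.intervalIntegrable_rpow' (a := 0) (b := 1) (r := -β) (by linarith)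
    rwa [intervalIntegrable_iff_integrableOn_Ioc_of_le zero_le_one] at this
  have h2 : Integrable (Set.indicator (Set.Ioi (1:ℝ)) (fun t => t ^ (-3:ℝ))) := by
    rw [integrable_indicator_iff measurableSet_Ioi]
    exact integrableOn_Ioi_rpow_of_lt (by norm_num) one_pos
  have h3 := h1.add h2
  have h4 := h3.add h3.comp_neg
  have h5 : Integrable (hsPsi β) := by
    refine h4.congr ?_
    have : ∀ᵐ t : ℝ, t ≠ 0 := by simp [ae_iff]
    filter_upwards [this] with t ht
    simp only [Pi.add_apply, Set.indicator, Set.mem_Ioc, Set.mem_Ioi, hsPsi]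
    rcases lt_or_gt_of_ne ht with h | h
    · rw [abs_of_neg h]
      by_cases h' : -t ≤ 1
      · simp [h, h', not_lt.2 h', not_lt.2 h.le, not_lt.2 (h.le.trans zero_le_one)]
      · simp [h, h', not_le.1 h', not_lt.2 h.le, not_lt.2 (h.le.trans zero_le_one)]
    · rw [abs_of_pos h]
      have : ¬ 1 < -t := by linarith
      by_cases h' : t ≤ 1
      · simp [h, h', not_lt.2 h', not_lt.2 h.le, this]
      · simp [h, h', not_le.1 h', not_lt.2 h.le, this]
  exact h5.lintegral_lt_top

lemma hs_pointwise (β l M t0 y t : ℝ) (hβ : 0 ≤ β) (hβ1 : β < 1) (hl : 0 < l) (hM : 0 < M)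
    (ht0 : t0 = 1 / (l * M ^ 2)) (hy : 0 ≤ y) (hyM : y ≤ M) :
    y ^ (6 - 2 * β) * |t| ^ (-β) ≤ l ^ β * y ^ 6 + M ^ (6 - 2 * β) * t0 ^ (-β) * hsPsi β (t / t0) := by
  have ht0p : 0 < t0 := by rw [ht0]; positivity
  have hn : 0 ≤ l ^ β * y ^ 6 := by positivity
  unfold hsPsi
  have ha : |t / t0| = |t| / t0 := by rw [abs_div, abs_of_pos ht0p]
  rw [ha]
  split_ifs with h
  · have : y ^ (6 - 2 * β) ≤ M ^ (6 - 2 * β) := by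
      apply Real.rpow_le_rpow hy hyM; linarith
    have e : t0 ^ (-β) * (|t| / t0) ^ (-β) = |t| ^ (-β) := by
      rw [← Real.mul_rpow ht0p.le (by positivity)]; congr 1; field_simp
    rw [mul_assoc, e]
    have : y ^ (6 - 2 * β) * |t| ^ (-β) ≤ M ^ (6 - 2 * β) * |t| ^ (-β) := by gcongr
    linarith
  · push Not at h
    have ht : 0 < |t| := by
      by_contra hh
      have : |t| = 0 := le_antisymm (not_lt.1 hh) (abs_nonneg _)
      rw [this] at h; simp at h; linarith
    have hn2 : 0 ≤ M ^ (6 - 2 * β) * t0 ^ (-β) * (|t| / t0) ^ (-3:ℝ) := by positivity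
    by_cases hc : |t|⁻¹ ≤ l * y ^ 2
    · have hy0 : 0 < y := by
        rcases hy.eq_or_lt with h0 | h0
        · rw [← h0] at hc; have := inv_pos.2 ht; norm_num at hc; rw [hc] at ht; norm_num at ht
        · exact h0
      have : |t| ^ (-β) ≤ l ^ β * y ^ (2 * β) := by
        rw [Real.rpow_neg ht.le, ← Real.inv_rpow ht.le]
        refine (Real.rpow_le_rpow (by positivity) hc hβ).trans_eq ?_
        rw [Real.mul_rpow hl.le (by positivity), Real.rpow_mul hy]; norm_num
      have e : y ^ (6 - 2 * β) * y ^ (2 * β) = y ^ 6 := by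
        rw [← Real.rpow_add hy0]; norm_num
      calc _ ≤ y ^ (6 - 2 * β) * (l ^ β * y ^ (2 * β)) := by gcongr
        _ = l ^ β * y ^ 6 := by rw [← e]; ring
        _ ≤ _ := by linarith
    · push Not at hc
      have h1 : y ^ 2 ≤ (l * |t|)⁻¹ := by
        rw [mul_inv, inv_mul_eq_div, le_div_iff₀ hl]; linarith
      have h2 : y ^ (6 - 2 * β) ≤ (l * |t|)⁻¹ ^ (3 - β) := by
        have := Real.rpow_le_rpow (by positivity) h1 (show 0 ≤ 3 - β by linarith)
        refine le_trans (le_of_eq ?_) this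
        rw [show 6 - 2 * β = 2 * (3 - β) by ring, Real.rpow_mul hy]; norm_num
      have e : (l * |t|)⁻¹ ^ (3 - β) * |t| ^ (-β) = M ^ (6 - 2 * β) * t0 ^ (-β) * (|t| / t0) ^ (-3:ℝ) := by
        have hlM : l = t0⁻¹ * (M ^ 2)⁻¹ := by rw [ht0]; field_simp
        rw [hlM, show (t0⁻¹ * (M ^ 2)⁻¹ * |t|)⁻¹ = t0 * M ^ 2 * |t|⁻¹ by field_simp]
        rw [Real.mul_rpow (by positivity) (by positivity), Real.mul_rpow (by positivity) (by positivity),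
          Real.div_rpow (by positivity) (by positivity), Real.inv_rpow (by positivity),
          show 6 - 2 * β = 2 * (3 - β) by ring, Real.rpow_mul hM.le,
          Real.rpow_sub ht0p, Real.rpow_sub ht, Real.rpow_neg ht.le, Real.rpow_neg ht.le,
          Real.rpow_neg ht0p.le, Real.rpow_neg ht0p.le]
        have := Real.rpow_pos_of_pos ht β
        have := Real.rpow_pos_of_pos ht0p β
        norm_num
        field_simp
      have : y ^ (6 - 2 * β) * |t| ^ (-β) ≤ (l * |t|)⁻¹ ^ (3 - β) * |t| ^ (-β) := by gcongr
      linarith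

lemma hs_one_dim (β l : ℝ) (hβ : 0 ≤ β) (hβ1 : β < 1) (hl : 0 < l) (g : ℝ → ℝ)
    (hg : ContDiff ℝ 1 g) (hc : HasCompactSupport g) :
    ∫⁻ t, ENNReal.ofReal (|g t| ^ (6 - 2 * β) * |t| ^ (-β)) ≤
      ∫⁻ t, (ENNReal.ofReal (l ^ β) * ‖g t‖ₑ ^ 6 +
        ENNReal.ofReal (l ^ (β - 1)) * (∫⁻ s, ENNReal.ofReal (hsPsi β s)) *
          (4 * (‖g t‖ₑ ^ 3 * ‖deriv g t‖ₑ))) := by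
  set c := ∫⁻ s, ENNReal.ofReal (hsPsi β s) with hcdef
  have hgc : Continuous g := hg.continuous
  obtain ⟨a, ha⟩ := (continuous_abs.comp hgc).exists_forall_ge_of_hasCompactSupport
    (by exact hc.comp_left abs_zero)
  simp only [Function.comp] at ha
  set M := |g a| with hMdef
  rcases (abs_nonneg (g a)).eq_or_lt with h0 | hM
  · have : ∀ t, g t = 0 := fun t => by
      have := ha t
      rw [hMdef, ← h0] at this
      exact abs_eq_zero.1 (le_antisymm this (abs_nonneg _))
    have h6 : 6 - 2 * β ≠ 0 := by linarith
    simp [this, Real.zero_rpow h6]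
  rw [← hMdef] at hM
  set t0 := 1 / (l * M ^ 2) with ht0
  have ht0p : 0 < t0 := by positivity
  have hM4 : ENNReal.ofReal (M ^ 4) ≤ ∫⁻ t, 4 * (‖g t‖ₑ ^ 3 * ‖deriv g t‖ₑ) := by
    have := HasCompactSupport.enorm_le_lintegral_Ici_deriv (f := fun t => g t ^ 4) (hg.pow 4)
      (hc.comp_left (g := fun y : ℝ => y ^ 4) (by norm_num)) a
    calc ENNReal.ofReal (M ^ 4) = ‖g a ^ 4‖ₑ := by
          rw [← ofReal_norm, norm_pow, Real.norm_eq_abs]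
      _ ≤ _ := this
      _ ≤ ∫⁻ t, ‖deriv (fun t => g t ^ 4) t‖ₑ := setLIntegral_le_lintegral _ _
      _ = _ := by
        refine lintegral_congr fun t => ?_
        have hd : HasDerivAt (fun t => g t ^ 4) _ t :=
          ((hg.differentiable one_ne_zero) t).hasDerivAt.pow 4
        rw [hd.deriv]
        simp only [enorm_mul, enorm_pow, mul_assoc]
        norm_num
        congr 1
        rw [← ofReal_norm]; norm_num
  have hgm : Measurable fun t => ENNReal.ofReal (l ^ β) * ‖g t‖ₑ ^ 6 := by
    have := hgc.measurable
    fun_prop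
  have hdm : Measurable (deriv g) := measurable_deriv g
  rw [lintegral_add_left hgm, lintegral_const_mul (ENNReal.ofReal (l ^ (β - 1)) * c)
    (by have := hgc.measurable; fun_prop)]
  have hscale : ∫⁻ t, ENNReal.ofReal (hsPsi β (t / t0)) = ENNReal.ofReal t0 * c := by
    have h := Real.smul_map_volume_mul_right (inv_ne_zero ht0p.ne')
    have hm := lintegral_map (μ := (volume : Measure ℝ)) (hsPsi_meas β).ennreal_ofReal
      (measurable_mul_const t0⁻¹)
    rw [Real.map_volume_mul_right (inv_ne_zero ht0p.ne')] at hm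
    simp only [div_eq_mul_inv]
    rw [← hm, lintegral_smul_measure, inv_inv, abs_of_pos ht0p]
    rfl
  have hpm : Measurable fun t => ENNReal.ofReal (hsPsi β (t / t0)) :=
    ((hsPsi_meas β).comp (measurable_id.div_const t0)).ennreal_ofReal
  calc _ ≤ ∫⁻ t, (ENNReal.ofReal (l ^ β) * ‖g t‖ₑ ^ 6 +
        ENNReal.ofReal (M ^ (6 - 2 * β) * t0 ^ (-β)) * ENNReal.ofReal (hsPsi β (t / t0))) := by
        refine lintegral_mono fun t => ?_
        have := hs_pointwise β l M t0 |g t| t hβ hβ1 hl hM ht0 (abs_nonneg _) (ha t)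
        refine (ENNReal.ofReal_le_ofReal this).trans_eq ?_
        have := hsPsi_nonneg β (t / t0)
        rw [ENNReal.ofReal_add (by positivity) (by positivity), ENNReal.ofReal_mul (by positivity),
          ENNReal.ofReal_mul (p := M ^ (6 - 2 * β) * t0 ^ (-β)) (by positivity), 
          ENNReal.ofReal_pow (abs_nonneg _), ← Real.norm_eq_abs (g t), ofReal_norm]
    _ = (∫⁻ t, ENNReal.ofReal (l ^ β) * ‖g t‖ₑ ^ 6) + 
        ENNReal.ofReal (l ^ (β - 1)) * c * ENNReal.ofReal (M ^ 4) := by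
        rw [lintegral_add_left hgm, lintegral_const_mul _ hpm, hscale]
        congr 1
        rw [← mul_assoc, ← ENNReal.ofReal_mul (by positivity), mul_right_comm (ENNReal.ofReal (l ^ (β - 1))),
          ← ENNReal.ofReal_mul (by positivity)]
        congr 2
        have e : t0 ^ (-β) * t0 = t0 ^ (1 - β) := by
          conv_lhs => rw [← Real.rpow_one t0, ← Real.rpow_mul ht0p.le, ← Real.rpow_add ht0p]
          congr 1; ring
        have e2 : t0 ^ (1 - β) = l ^ (β - 1) * M ^ (2 * β - 2) := by
          rw [ht0, one_div, Real.inv_rpow (by positivity), ← Real.rpow_neg (by positivity),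
            Real.mul_rpow hl.le (by positivity), ← Real.rpow_natCast M 2, ← Real.rpow_mul hM.le]
          congr 2 <;> push_cast <;> ring
        have e3 : M ^ (6 - 2 * β) * M ^ (2 * β - 2) = M ^ 4 := by
          rw [← Real.rpow_add hM, ← Real.rpow_natCast]; congr 1; push_cast; ring
        rw [mul_assoc, e, e2, ← e3]; ring
    _ ≤ _ := by gcongr

lemma hs_slice (F G : (Fin 3 → ℝ) → ℝ≥0∞) (hF : Measurable F) (hG : Measurable G)
    (h : ∀ x : Fin 3 → ℝ, ∫⁻ t, F (Function.update x 2 t) ≤ ∫⁻ t, G (Function.update x 2 t)) :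
    ∫⁻ x, F x ≤ ∫⁻ x, G x := by
  have key : ∀ H : (Fin 3 → ℝ) → ℝ≥0∞, Measurable H → ∫⁻ x, H x =
      ∫⁻ y : (Fin 2 → ℝ), ∫⁻ t : ℝ, H (Function.update (Fin.insertNth (α := fun _ => ℝ) (2 : Fin 3) (0:ℝ) y) 2 t) := by
    intro H hH
    have hem := (volume_preserving_piFinSuccAbove (fun _ : Fin 3 => ℝ) 2).symm
    rw [← hem.lintegral_comp hH, Measure.volume_eq_prod, lintegral_prod_symm]
    · refine lintegral_congr fun y => lintegral_congr fun t => ?_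
      congr 1
      rw [Fin.update_insertNth]
      rfl
    · exact (hH.comp (MeasurableEquiv.measurable _)).aemeasurable
  rw [key F hF, key G hG]
  exact lintegral_mono fun y => h _

lemma hs_three_dim (β l : ℝ) (hβ : 0 ≤ β) (hβ1 : β < 1) (hl : 0 < l) (f : (Fin 3 → ℝ) → ℝ)
    (hf : ContDiff ℝ 1 f) (hc : HasCompactSupport f) :
    ∫⁻ x, ENNReal.ofReal (|f x| ^ (6 - 2 * β) * |x 2| ^ (-β)) ≤
      ∫⁻ x, (ENNReal.ofReal (l ^ β) * ‖f x‖ₑ ^ 6 +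
        ENNReal.ofReal (l ^ (β - 1)) * (∫⁻ s, ENNReal.ofReal (hsPsi β s)) *
          (4 * (‖f x‖ₑ ^ 3 * ‖fderiv ℝ f x‖ₑ))) := by
  have hfm := hf.continuous.measurable
  have hdf : Measurable (fderiv ℝ f) := measurable_fderiv ℝ f
  apply hs_slice
  · fun_prop
  · fun_prop
  intro x
  have hg : ContDiff ℝ 1 (f ∘ Function.update x 2) := hf.comp (by convert! contDiff_update 1 x 2)
  have hgc : HasCompactSupport (f ∘ Function.update x 2) :=
    hc.comp_isClosedEmbedding (isClosedEmbedding_update x 2)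
  have := hs_one_dim β l hβ hβ1 hl _ hg hgc
  simp only [Function.comp, Function.update_self] at this ⊢
  refine this.trans ?_
  gcongr with t
  have hd := ((hf.differentiable one_ne_zero) (Function.update x 2 t)).hasFDerivAt.comp_hasDerivAt t
    (hasDerivAt_update x 2 t)
  rw [hd.deriv]
  refine (ContinuousLinearMap.le_opENorm _ _).trans ?_
  have e1 : ‖(Pi.single 2 1 : Fin 3 → ℝ)‖ₑ = 1 := by
    rw [← ofReal_norm, Pi.norm_single]; simp
  rw [e1, mul_one]

theorem hardy_sobolev_x3_weight_H1
    (α : ℝ) (hα0 : 0 ≤ α) (hα : α < 1 / 4) :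
    ∃ C : ℝ, 0 < C ∧ ∀ f : (Fin 3 → ℝ) → ℝ,
      ContDiff ℝ (⊤ : ℕ∞) f → HasCompactSupport f →
      eLpNorm (fun x => f x / |x 2| ^ α) (ENNReal.ofReal (6 / (1 + 2 * α))) volume
        ≤ ENNReal.ofReal C * eLpNorm (fderiv ℝ f) 2 volume := by
  obtain ⟨q, hq⟩ : ∃ q, q = 6 / (1 + 2 * α) := ⟨_, rfl⟩
  obtain ⟨β, hβdef⟩ : ∃ β, β = α * q := ⟨_, rfl⟩
  have hp : 0 < 1 + 2 * α := by linarith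
  have hq0 : 0 < q := by rw [hq]; positivity
  have hβ : 0 ≤ β := by rw [hβdef]; positivity
  have hβ1 : β < 1 := by
    rw [hβdef, hq, mul_div_assoc', div_lt_one hp]; linarith
  have hqβ : q = 6 - 2 * β := by
    rw [hβdef, hq]; field_simp; ring
  rw [← hq]
  set K : NNReal := eLpNormLESNormFDerivOfEqInnerConst (volume : Measure (Fin 3 → ℝ)) 2 with hK
  obtain ⟨c, hc⟩ : ∃ c : NNReal, (c : ℝ≥0∞) = ∫⁻ s, ENNReal.ofReal (hsPsi β s) :=
    ⟨_, ENNReal.coe_toNNReal (hsPsi_lt_top β hβ1).ne⟩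
  set D : NNReal := K ^ 6 + c * 4 * K ^ 3 + 1 with hD
  refine ⟨(D : ℝ) ^ (1 / q), by positivity, fun f hf hfc => ?_⟩
  have hf1 : ContDiff ℝ 1 f := hf.of_le (by exact_mod_cast le_top)
  have hfm := hf1.continuous.measurable
  have hdf : Measurable (fderiv ℝ f) := measurable_fderiv ℝ f
  have hsob : eLpNorm f 6 volume ≤ K * eLpNorm (fderiv ℝ f) 2 volume := by
    have := eLpNorm_le_eLpNorm_fderiv_of_eq_inner (volume : Measure (Fin 3 → ℝ)) (p := 2) (p' := 6)
      hf1 hfc (by norm_num) (by simp) (by simp; norm_num)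
    exact_mod_cast this
  have hSfin : eLpNorm (fderiv ℝ f) 2 volume ≠ ⊤ :=
    ((hf1.continuous_fderiv one_ne_zero).memLp_of_hasCompactSupport
      (hfc.fderiv ℝ)).eLpNorm_ne_top
  have hint : eLpNorm (fun x => f x / |x 2| ^ α) (ENNReal.ofReal q) volume =
      (∫⁻ x : Fin 3 → ℝ, ENNReal.ofReal (|f x| ^ (6 - 2 * β) * |x 2| ^ (-β))) ^ (1 / q) := by
    rw [eLpNorm_eq_lintegral_rpow_enorm_toReal (by simpa using hq0) (by simp),
      ENNReal.toReal_ofReal hq0.le]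
    congr 1
    refine lintegral_congr fun x => ?_
    rw [← ofReal_norm, ENNReal.ofReal_rpow_of_nonneg (norm_nonneg _) hq0.le]
    congr 1
    rw [norm_div, Real.norm_eq_abs, Real.norm_of_nonneg (by positivity),
      Real.div_rpow (by positivity) (by positivity), ← Real.rpow_mul (abs_nonneg _), ← hβdef, hqβ,
      Real.rpow_neg (abs_nonneg _), div_eq_mul_inv]
  rcases eq_or_ne (eLpNorm (fderiv ℝ f) 2 volume) 0 with hS0 | hS0
  · rw [hS0, mul_zero, nonpos_iff_eq_zero] at hsob
    rw [eLpNorm_eq_zero_iff hfm.aestronglyMeasurable (by norm_num)] at hsob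
    rw [eLpNorm_congr_ae (g := 0) (by filter_upwards [hsob] with x hx; simp [hx])]
    simp
  obtain ⟨S, hS⟩ : ∃ S : NNReal, (S : ℝ≥0∞) = eLpNorm (fderiv ℝ f) 2 volume :=
    ⟨_, ENNReal.coe_toNNReal hSfin⟩
  rw [← hS] at hS0 hsob ⊢
  have hSpos : 0 < (S : ℝ) := by
    have : S ≠ 0 := by exact_mod_cast hS0
    positivity
  have h6 : ∫⁻ x, ‖f x‖ₑ ^ 6 = eLpNorm f 6 volume ^ 6 := by
    have := eLpNorm_nnreal_pow_eq_lintegral (μ := volume) (f := f) (p := 6) (by norm_num)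
    have e : ∀ z : ℝ≥0∞, z ^ ((6 : NNReal) : ℝ) = z ^ 6 := fun z => by
      rw [← ENNReal.rpow_natCast]; norm_num
    simp only [e] at this
    exact_mod_cast this.symm
  have h2 : ∫⁻ x, ‖fderiv ℝ f x‖ₑ ^ 2 = (S : ℝ≥0∞) ^ 2 := by
    have := eLpNorm_nnreal_pow_eq_lintegral (μ := volume) (f := fderiv ℝ f) (p := 2) (by norm_num)
    rw [hS]
    have e : ∀ z : ℝ≥0∞, z ^ ((2 : NNReal) : ℝ) = z ^ 2 := fun z => by
      rw [← ENNReal.rpow_natCast]; norm_num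
    simp only [e] at this
    exact_mod_cast this.symm
  have h3 : ∫⁻ x, ‖f x‖ₑ ^ 3 * ‖fderiv ℝ f x‖ₑ ≤ (K * S : ℝ≥0∞) ^ 3 * S := by
    have := ENNReal.lintegral_mul_le_Lp_mul_Lq (volume : Measure (Fin 3 → ℝ))
      (Real.HolderConjugate.two_two) (f := fun x => ‖f x‖ₑ ^ 3) (g := fun x => ‖fderiv ℝ f x‖ₑ)
      (by fun_prop) (by fun_prop)
    refine this.trans ?_
    simp only [ENNReal.rpow_two, ← pow_mul]
    norm_num only
    rw [h6, h2]
    have e1 : ∀ z : ℝ≥0∞, (z ^ 2) ^ (1 / 2 : ℝ) = z := fun z => by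
      rw [← ENNReal.rpow_two, ← ENNReal.rpow_mul]; norm_num
    rw [show eLpNorm f 6 volume ^ 6 = (eLpNorm f 6 volume ^ 3) ^ 2 by rw [← pow_mul], e1, e1]
    gcongr
  set l : ℝ := (S : ℝ) ^ (-2 : ℝ) with hl
  have hlpos : 0 < l := by positivity
  have main := hs_three_dim β l hβ hβ1 hlpos f hf1 hfc
  rw [lintegral_add_left (by fun_prop), lintegral_const_mul _ (by fun_prop),
    lintegral_const_mul _ (by fun_prop), lintegral_const_mul _ (by fun_prop), h6, ← hc] at main
  have main2 : ∫⁻ x : Fin 3 → ℝ, ENNReal.ofReal (|f x| ^ (6 - 2 * β) * |x 2| ^ (-β)) ≤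
      ENNReal.ofReal (D * S ^ q) := by
    refine main.trans ?_
    calc _ ≤ ENNReal.ofReal (l ^ β) * (K * S : ℝ≥0∞) ^ 6 +
          ENNReal.ofReal (l ^ (β - 1)) * c * (4 * ((K * S : ℝ≥0∞) ^ 3 * S)) := by gcongr
      _ = ENNReal.ofReal (l ^ β * (K * S) ^ 6 + l ^ (β - 1) * c * (4 * ((K * S) ^ 3 * S))) := by
        rw [ENNReal.ofReal_add (by positivity) (by positivity)]
        rw [ENNReal.ofReal_mul (by positivity), ENNReal.ofReal_mul (by positivity),
          ENNReal.ofReal_mul (by positivity), ENNReal.ofReal_mul (by positivity),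
          ENNReal.ofReal_mul (by positivity),
          ENNReal.ofReal_pow (by positivity), ENNReal.ofReal_pow (by positivity),
          ENNReal.ofReal_mul (by positivity)]
        simp
      _ ≤ _ := by
        apply ENNReal.ofReal_le_ofReal
        have e1 : l ^ β * (S:ℝ) ^ 6 = S ^ q := by
          rw [hl, ← Real.rpow_mul hSpos.le, ← Real.rpow_natCast (S:ℝ) 6, ← Real.rpow_add hSpos, hqβ]
          congr 1; push_cast; ring
        have e2 : l ^ (β - 1) * (S:ℝ) ^ 4 = S ^ q := by
          rw [hl, ← Real.rpow_mul hSpos.le, ← Real.rpow_natCast (S:ℝ) 4, ← Real.rpow_add hSpos, hqβ]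
          congr 1; push_cast; ring
        have hn : 0 ≤ (S:ℝ) ^ q := by positivity
        calc l ^ β * (K * S) ^ 6 + l ^ (β - 1) * c * (4 * ((K * S) ^ 3 * S))
            = K ^ 6 * (l ^ β * (S:ℝ) ^ 6) + c * 4 * K ^ 3 * (l ^ (β - 1) * (S:ℝ) ^ 4) := by ring
          _ = (K ^ 6 + c * 4 * K ^ 3) * (S:ℝ) ^ q := by rw [e1, e2]; ring
          _ ≤ _ := by
            rw [hD]; push_cast; nlinarith
  rw [hint]
  calc _ ≤ (ENNReal.ofReal (D * S ^ q)) ^ (1 / q) := by gcongr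
    _ = _ := by
      rw [ENNReal.ofReal_rpow_of_nonneg (by positivity) (by positivity),
        Real.mul_rpow (by positivity) (by positivity), ← Real.rpow_mul hSpos.le,
        mul_one_div_cancel hq0.ne', Real.rpow_one, ENNReal.ofReal_mul (by positivity)]
      simp
end

section
/- Let 0 < α < 1/4 and set r = √(x_1² + x_2²). Then there exists a constant C>0 such that for all f ∈ C_0^∞(ℝ³), ‖ f / ( |x_3|^{α/2} r^{1/2} ) ‖_{L^{6/(2+α)}(ℝ³)} ≤ C ‖ ∇f ‖_{L^2(ℝ³)}. -/
open MeasureTheory ENNReal Real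

noncomputable section

/-- distance to the axis -/
def hsR (x : Fin 3 → ℝ) : ℝ := Real.sqrt (x 0 ^ 2 + x 1 ^ 2)

lemma hsR_nonneg (x : Fin 3 → ℝ) : 0 ≤ hsR x := Real.sqrt_nonneg _

lemma hsR_meas : Measurable hsR := by unfold hsR; fun_prop

lemma refl_lint (g : ℝ → ℝ≥0∞) :
    ∫⁻ τ in Set.Iic (0:ℝ), g (-τ) = ∫⁻ τ in Set.Ici (0:ℝ), g τ := by
  have := (Measure.measurePreserving_neg (volume : Measure ℝ)).setLIntegral_comp_preimage_emb
    (MeasurableEquiv.neg ℝ).measurableEmbedding g (Set.Ici 0)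
  simpa using this

/-- one dimensional bound along a ray -/
lemma ray_bound (f : (Fin 3 → ℝ) → ℝ) (hf : ContDiff ℝ 1 f) (hc : HasCompactSupport f)
    (q : ℝ) (hq : 1 < q) (x v : Fin 3 → ℝ) (hv : v ≠ 0) :
    ‖f x‖ₑ ^ q ≤ ∫⁻ τ in Set.Ici (0:ℝ),
      ENNReal.ofReal q * ‖f (x + τ • v)‖ₑ ^ (q - 1) * ‖fderiv ℝ f (x + τ • v)‖ₑ * ‖v‖ₑ := by
  set u : (Fin 3 → ℝ) → ℝ := fun y => ‖f y‖ ^ q with hu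
  have hu1 : ContDiff ℝ 1 u := hf.norm_rpow hq
  have hu2 : HasCompactSupport u := by
    apply hc.comp_left (g := fun y : ℝ => ‖y‖ ^ q)
    simp [Real.zero_rpow (by linarith : q ≠ 0)]
  set γ : ℝ → (Fin 3 → ℝ) := fun τ => x - τ • v with hγ
  have hγd : ∀ τ, HasDerivAt γ (-v) τ := fun τ => by
    simpa using ((hasDerivAt_id τ).smul_const v).const_sub x
  have hemb : Topology.IsClosedEmbedding γ := by
    have h1 := (isClosedEmbedding_smul_left (𝕜 := ℝ) hv)
    have h2 := (Homeomorph.subLeft x).isClosedEmbedding.comp h1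
    exact h2
  have h := HasCompactSupport.enorm_le_lintegral_Ici_deriv (f := u ∘ γ)
    (hu1.comp (by fun_prop)) (hu2.comp_isClosedEmbedding hemb) 0
  have e1 : ‖(u ∘ γ) 0‖ₑ = ‖f x‖ₑ ^ q := by
    simp only [hu, hγ, Function.comp, zero_smul, sub_zero]
    rw [Real.enorm_rpow_of_nonneg (norm_nonneg _) (by linarith), enorm_norm]
  rw [e1] at h
  refine h.trans ?_
  rw [← refl_lint]
  apply lintegral_mono
  intro τ
  simp only [Function.comp_def]
  have hd : deriv (fun s => u (γ s)) τ = fderiv ℝ u (γ τ) (-v) :=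
    ((hu1.differentiable one_ne_zero (γ τ)).hasFDerivAt.comp_hasDerivAt τ (hγd τ)).deriv
  rw [hd]
  refine (ContinuousLinearMap.le_opENorm _ _).trans ?_
  rw [enorm_neg]
  have e2 : x + -τ • v = γ τ := by simp [hγ, sub_eq_add_neg]
  rw [e2]
  gcongr
  have := enorm_fderiv_norm_rpow_le (hf.differentiable one_ne_zero) (x := γ τ) (p := ⟨q, by linarith⟩)
    (by exact_mod_cast hq)
  have e5 : ENNReal.ofReal q = ENNReal.ofNNReal (⟨q, by linarith⟩ : NNReal) :=
    ENNReal.ofReal_eq_coe_nnreal (by linarith : 0 ≤ q)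
  rw [e5]
  exact this

/-- horizontal dilation -/
lemma dil_lintegral (l : ℝ) (hl : 0 < l) (G : (Fin 3 → ℝ) → ℝ≥0∞) (hG : Measurable G) :
    ∫⁻ x : Fin 3 → ℝ, G (fun i => ![l, l, 1] i * x i) = ENNReal.ofReal (l ^ (-2:ℝ)) * ∫⁻ x, G x := by
  have hdet : (Matrix.diagonal ![l, l, 1]).det = l ^ 2 := by
    rw [Matrix.det_diagonal, Fin.prod_univ_three]; simp; ring
  have hl2 : 0 < l ^ 2 := by positivity
  have h := Real.smul_map_diagonal_volume_pi (D := ![l, l, 1]) (by rw [hdet]; positivity)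
  rw [hdet, abs_of_pos hl2] at h
  conv_rhs => rw [← h]
  rw [lintegral_smul_measure, lintegral_map hG (by fun_prop), smul_eq_mul, ← mul_assoc,
    ← ENNReal.ofReal_mul (by positivity)]
  have : l ^ (-2:ℝ) * l ^ 2 = 1 := by
    rw [Real.rpow_neg hl.le]; norm_num; field_simp
  rw [this]
  rw [ENNReal.ofReal_one, one_mul]
  congr! 3 with x
  ext i
  simp [Matrix.toLin'_apply, Matrix.mulVec_diagonal]

/-- horizontal Hardy inequality -/
lemma horiz (c q : ℝ) (hc0 : 0 < c) (hc2 : c < 2) (hq : 1 < q) : ∃ K : NNReal,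
    ∀ f : (Fin 3 → ℝ) → ℝ, ContDiff ℝ 1 f → HasCompactSupport f →
    ∫⁻ x, ‖f x‖ₑ ^ q * ENNReal.ofReal (hsR x ^ (-c)) ≤
      K * ∫⁻ x, ‖f x‖ₑ ^ (q - 1) * ‖fderiv ℝ f x‖ₑ * ENNReal.ofReal (hsR x ^ (1 - c)) := by
  set A : ℝ≥0∞ := ∫⁻ τ in Set.Ici (0:ℝ), ENNReal.ofReal ((1 + τ) ^ (c - 3)) with hA
  have hAf : A ≠ ⊤ := by
    rw [hA, ← restrict_Ioi_eq_restrict_Ici]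
    have := integrableOn_add_rpow_Ioi_of_lt (a := c - 3) (c := 0) (m := 1) (by linarith) (by norm_num)
    simp_rw [add_comm (1:ℝ)]
    exact this.lintegral_lt_top.ne
  refine ⟨(ENNReal.ofReal q * A).toNNReal, fun f hf hc => ?_⟩
  rw [ENNReal.coe_toNNReal (by finiteness)]
  have hcf : Continuous (fderiv ℝ f) := hf.continuous_fderiv one_ne_zero
  have hfc : Continuous f := hf.continuous
  set H : (Fin 3 → ℝ) → ℝ≥0∞ := fun x => ‖f x‖ₑ ^ (q - 1) * ‖fderiv ℝ f x‖ₑ with hH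
  have hHm : Measurable H := by
    have := hfc.measurable; have := hcf.measurable; fun_prop
  have hRm := hsR_meas
  have key : ∀ x, ‖f x‖ₑ ^ q * ENNReal.ofReal (hsR x ^ (-c)) ≤
      ∫⁻ τ in Set.Ici (0:ℝ), ENNReal.ofReal q * (H (fun i => ![1 + τ, 1 + τ, 1] i * x i) *
        ENNReal.ofReal (hsR x ^ (1 - c))) := by
    intro x
    by_cases hx : hsR x = 0
    · rw [hx, Real.zero_rpow (by linarith)]; simp
    have hxp : 0 < hsR x := lt_of_le_of_ne (hsR_nonneg x) (Ne.symm hx)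
    set v : Fin 3 → ℝ := ![x 0, x 1, 0] with hv
    have hv0 : v ≠ 0 := by
      intro h
      apply hx
      have h0 := congrFun h 0
      have h1 := congrFun h 1
      simp [hv] at h0 h1
      simp [hsR, h0, h1]
    have hvn : ‖v‖ₑ ≤ ENNReal.ofReal (hsR x) := by
      rw [← ofReal_norm]
      apply ENNReal.ofReal_le_ofReal
      rw [pi_norm_le_iff_of_nonneg (hsR_nonneg x)]
      intro i
      fin_cases i
      · simp only [hv, hsR, Real.norm_eq_abs]; exact Real.abs_le_sqrt (by simp; positivity)
      · simp only [hv, hsR, Real.norm_eq_abs]; exact Real.abs_le_sqrt (by simp; positivity)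
      · simp [hv, hsR_nonneg]
    have hray := ray_bound f hf hc q hq x v hv0
    calc _ ≤ _ := mul_le_mul_left hray _
      _ = ∫⁻ τ in Set.Ici (0:ℝ), (ENNReal.ofReal q * ‖f (x + τ • v)‖ₑ ^ (q - 1) * ‖fderiv ℝ f (x + τ • v)‖ₑ * ‖v‖ₑ) * ENNReal.ofReal (hsR x ^ (-c)) := by
          exact (lintegral_mul_const' _ _ (by finiteness)).symm
      _ ≤ _ := by
          apply lintegral_mono
          intro τ
          have e : x + τ • v = (fun i => ![1 + τ, 1 + τ, 1] i * x i) := by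
            ext i; fin_cases i <;> simp [hv] <;> ring
          simp only [hH, e]
          rw [show hsR x ^ (1 - c) = hsR x * hsR x ^ (-c) by
            rw [sub_eq_add_neg, Real.rpow_add hxp, Real.rpow_one],
            ENNReal.ofReal_mul hxp.le]
          calc _ ≤ ENNReal.ofReal q * ‖f _‖ₑ ^ (q - 1) * ‖fderiv ℝ f _‖ₑ * ENNReal.ofReal (hsR x) * ENNReal.ofReal (hsR x ^ (-c)) := by gcongr
            _ = _ := by ring
  have hm2 : Measurable (Function.uncurry fun (x : Fin 3 → ℝ) (τ : ℝ) => ENNReal.ofReal q * (H (fun i => ![1 + τ, 1 + τ, 1] i * x i) *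
        ENNReal.ofReal (hsR x ^ (1 - c)))) := by
    have : Measurable fun p : (Fin 3 → ℝ) × ℝ => (fun i => ![1 + p.2, 1 + p.2, 1] i * p.1 i) := by
      rw [measurable_pi_iff]
      intro i
      fin_cases i <;> simp <;> fun_prop
    have h2 := hHm.comp this
    simp only [Function.uncurry_def]
    exact ((h2.mul (by fun_prop)).const_mul _)
  calc _ ≤ _ := lintegral_mono key
    _ = _ := lintegral_lintegral_swap hm2.aemeasurable
    _ = ∫⁻ τ in Set.Ici (0:ℝ), ENNReal.ofReal q * (ENNReal.ofReal ((1 + τ) ^ (c - 3)) *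
          ∫⁻ x, H x * ENNReal.ofReal (hsR x ^ (1 - c))) := by
        apply setLIntegral_congr_fun measurableSet_Ici
        intro τ hτ
        have hτ0 : (0:ℝ) ≤ τ := hτ
        have hp : 0 < 1 + τ := by linarith
        simp only
        rw [lintegral_const_mul' _ _ (by finiteness)]
        congr 1
        have hd := dil_lintegral (1 + τ) hp (fun x => H x * ENNReal.ofReal (hsR x ^ (1 - c))) (by fun_prop)
        have hr : ∀ x, hsR (fun i => ![1 + τ, 1 + τ, 1] i * x i) = (1 + τ) * hsR x := by
          intro x
          simp only [hsR]
          rw [show (![1 + τ, 1 + τ, 1] 0 * x 0) ^ 2 + (![1 + τ, 1 + τ, 1] 1 * x 1) ^ 2 = (1 + τ) ^ 2 * (x 0 ^ 2 + x 1 ^ 2) by simp; ring,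
            Real.sqrt_mul (by positivity), Real.sqrt_sq hp.le]
        simp_rw [hr, Real.mul_rpow hp.le (hsR_nonneg _)] at hd
        have e3 : (1 + τ) ^ (c - 3) = (1 + τ) ^ (c - 1) * (1 + τ) ^ (-2:ℝ) := by
          rw [← Real.rpow_add hp]; ring_nf
        rw [e3, ENNReal.ofReal_mul (by positivity), mul_assoc, ← hd, ← lintegral_const_mul' _ _ (by finiteness)]
        refine lintegral_congr fun x => ?_
        rw [ENNReal.ofReal_mul (by positivity)]
        have e4 : ENNReal.ofReal ((1 + τ) ^ (c - 1)) * ENNReal.ofReal ((1 + τ) ^ (1 - c)) = 1 := by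
          rw [← ENNReal.ofReal_mul (by positivity), ← Real.rpow_add hp]; simp
        calc _ = (ENNReal.ofReal ((1 + τ) ^ (c - 1)) * ENNReal.ofReal ((1 + τ) ^ (1 - c))) * (H (fun i => ![1 + τ, 1 + τ, 1] i * x i) * ENNReal.ofReal (hsR x ^ (1 - c))) := by rw [e4, one_mul]
          _ = _ := by ring
    _ = _ := by
        rw [lintegral_const_mul' _ _ (by finiteness), lintegral_mul_const _ (by fun_prop), mul_assoc]

lemma oneD (β : ℝ) (hβ1 : β < 1) : ∃ B : NNReal, ∀ r : ℝ, 0 < r →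
    ∫⁻ s : ℝ, (if |s| < r then ENNReal.ofReal (|s| ^ (-β)) else 0) ≤
      B * ENNReal.ofReal (r ^ (1 - β)) := by
  set g : ℝ → ℝ → ℝ≥0∞ := fun r s => if |s| < r then ENNReal.ofReal (|s| ^ (-β)) else 0 with hg
  have hgm : ∀ r, Measurable (g r) := fun r =>
    Measurable.ite (measurableSet_lt (by fun_prop) (by fun_prop)) (by fun_prop) (by fun_prop)
  have hB : ∫⁻ s, g 1 s ≠ ⊤ := by
    have h1 : ∫⁻ s in Set.Ici (0:ℝ), g 1 s ≤ ∫⁻ s in Set.Ioc (0:ℝ) 1, ENNReal.ofReal (s ^ (-β)) := by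
      rw [← restrict_Ioi_eq_restrict_Ici, ← lintegral_indicator measurableSet_Ioi,
        ← lintegral_indicator measurableSet_Ioc]
      apply lintegral_mono
      intro s
      by_cases hs : 0 < s
      · by_cases hs1 : s < 1
        · simp [hg, Set.indicator, hs, hs1, hs1.le, abs_of_pos hs]
        · simp [hg, Set.indicator, hs, hs1, abs_of_pos hs]
      · simp [Set.indicator, hs]
    have h2 : ∫⁻ s in Set.Ioc (0:ℝ) 1, ENNReal.ofReal (s ^ (-β)) < ⊤ := by
      have := intervalIntegral.intervalIntegrable_rpow' (a := 0) (b := 1) (r := -β) (by linarith)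
      rw [intervalIntegrable_iff_integrableOn_Ioc_of_le (by norm_num)] at this
      exact this.lintegral_lt_top
    have h3 : ∫⁻ s in Set.Iic (0:ℝ), g 1 s = ∫⁻ s in Set.Ici (0:ℝ), g 1 s := by
      rw [← refl_lint]
      simp [hg]
    have h4 : ∫⁻ s, g 1 s ≤ (∫⁻ s in Set.Iic (0:ℝ), g 1 s) + ∫⁻ s in Set.Ici (0:ℝ), g 1 s := by
      rw [← setLIntegral_univ, ← Set.Iic_union_Ici (a := (0:ℝ))]
      exact lintegral_union_le _ _ _
    rw [h3] at h4
    have h5 := h1.trans_lt h2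
    exact (h4.trans_lt (ENNReal.add_lt_top.2 ⟨h5, h5⟩)).ne
  refine ⟨(∫⁻ s, g 1 s).toNNReal, fun r hr => ?_⟩
  rw [ENNReal.coe_toNNReal hB]
  change ∫⁻ s, g r s ≤ _
  conv_lhs => rw [← Real.smul_map_volume_mul_left hr.ne']
  rw [lintegral_smul_measure, lintegral_map (hgm r) (by fun_prop), abs_of_pos hr, smul_eq_mul]
  have : ∀ s, g r (r * s) = ENNReal.ofReal (r ^ (-β)) * g 1 s := by
    intro s
    simp only [hg, abs_mul, abs_of_pos hr]
    by_cases hs : |s| < 1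
    · rw [if_pos hs, if_pos (by nlinarith), Real.mul_rpow hr.le (abs_nonneg _),
        ENNReal.ofReal_mul (by positivity)]
    · rw [if_neg hs, if_neg (by nlinarith), mul_zero]
  simp_rw [this]
  rw [lintegral_const_mul' _ _ (by finiteness), ← mul_assoc, ← ENNReal.ofReal_mul hr.le, mul_comm,
    show 1 - β = 1 + -β by ring, Real.rpow_add hr, Real.rpow_one]

/-- vertical inequality near the plane -/
lemma vert (β γ q : ℝ) (hβ1 : β < 1) (hq : 1 < q) : ∃ K : NNReal,
    ∀ f : (Fin 3 → ℝ) → ℝ, ContDiff ℝ 1 f → HasCompactSupport f →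
    ∫⁻ x, ‖f x‖ₑ ^ q * (if |x 2| < hsR x then ENNReal.ofReal (|x 2| ^ (-β)) else 0)
        * ENNReal.ofReal (hsR x ^ (-γ)) ≤
      K * ∫⁻ x, ‖f x‖ₑ ^ (q - 1) * ‖fderiv ℝ f x‖ₑ * ENNReal.ofReal (hsR x ^ (1 - (β + γ))) := by
  obtain ⟨B, hB⟩ := oneD β hβ1
  refine ⟨(ENNReal.ofReal q).toNNReal * B, fun f hf hc => ?_⟩
  rw [ENNReal.coe_mul, ENNReal.coe_toNNReal (by finiteness)]
  have hcf : Continuous (fderiv ℝ f) := hf.continuous_fderiv one_ne_zero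
  have hfc : Continuous f := hf.continuous
  set H : (Fin 3 → ℝ) → ℝ≥0∞ := fun x => ‖f x‖ₑ ^ (q - 1) * ‖fderiv ℝ f x‖ₑ with hH
  have hHm : Measurable H := by
    have := hfc.measurable; have := hcf.measurable; fun_prop
  have hRm := hsR_meas
  set w : (Fin 3 → ℝ) → ℝ≥0∞ := fun x =>
    (if |x 2| < hsR x then ENNReal.ofReal (|x 2| ^ (-β)) else 0)
        * ENNReal.ofReal (hsR x ^ (-γ)) with hw
  have hwm : Measurable w :=
    (Measurable.ite (measurableSet_lt (by fun_prop) (by fun_prop)) (by fun_prop)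
      (by fun_prop)).mul (by fun_prop)
  have hwt : ∀ x, w x ≠ ⊤ := by
    intro x; simp only [hw]; split_ifs <;> finiteness
  set v : Fin 3 → ℝ := ![0, 0, 1] with hv
  have hv0 : v ≠ 0 := by
    intro h; have := congrFun h 2; simp [hv] at this
  have hvn : ‖v‖ₑ ≤ 1 := by
    rw [← ofReal_norm, ← ENNReal.ofReal_one]
    apply ENNReal.ofReal_le_ofReal
    rw [pi_norm_le_iff_of_nonneg zero_le_one]
    intro i
    fin_cases i <;> simp [hv]
  have key : ∀ x, ‖f x‖ₑ ^ q * w x ≤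
      ∫⁻ τ in Set.Ici (0:ℝ), ENNReal.ofReal q * (H (x + τ • v) * w x) := by
    intro x
    calc _ ≤ _ := mul_le_mul_left (ray_bound f hf hc q hq x v hv0) _
      _ = _ := (lintegral_mul_const' _ _ (hwt x)).symm
      _ ≤ _ := by
        apply lintegral_mono
        intro τ
        simp only [hH]
        calc _ ≤ ENNReal.ofReal q * ‖f (x + τ • v)‖ₑ ^ (q - 1) * ‖fderiv ℝ f (x + τ • v)‖ₑ * 1 * w x := by gcongr
          _ = _ := by ring
  have hm2 : Measurable (Function.uncurry fun (x : Fin 3 → ℝ) (τ : ℝ) =>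
      ENNReal.ofReal q * (H (x + τ • v) * w x)) := by
    have : Measurable fun p : (Fin 3 → ℝ) × ℝ => p.1 + p.2 • v := by fun_prop
    have h2 := hHm.comp this
    simp only [Function.uncurry_def]
    exact ((h2.mul (by fun_prop)).const_mul _)
  have hm3 : Measurable (Function.uncurry fun (τ : ℝ) (x : Fin 3 → ℝ) =>
      ENNReal.ofReal q * (H x * w (x - τ • v))) := by
    have : Measurable fun p : ℝ × (Fin 3 → ℝ) => p.2 - p.1 • v := by fun_prop
    have h2 := hwm.comp this
    simp only [Function.uncurry_def]
    exact (((hHm.comp measurable_snd).mul h2).const_mul _)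
  have hRv : ∀ (x : Fin 3 → ℝ) (τ : ℝ), hsR (x - τ • v) = hsR x := by
    intro x τ; simp [hsR, hv]
  simp_rw [mul_assoc (‖f _‖ₑ ^ q)]
  calc _ ≤ _ := lintegral_mono key
    _ = _ := lintegral_lintegral_swap hm2.aemeasurable
    _ = ∫⁻ τ in Set.Ici (0:ℝ), ∫⁻ x, ENNReal.ofReal q * (H x * w (x - τ • v)) := by
        congr! 2 with τ
        have := lintegral_add_right_eq_self (μ := (volume : Measure (Fin 3 → ℝ)))
          (fun x => ENNReal.ofReal q * (H x * w (x - τ • v))) (τ • v)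
        simpa using this
    _ = ∫⁻ x, ∫⁻ τ in Set.Ici (0:ℝ), ENNReal.ofReal q * (H x * w (x - τ • v)) :=
        lintegral_lintegral_swap hm3.aemeasurable
    _ ≤ ∫⁻ x, ENNReal.ofReal q * B * (H x * ENNReal.ofReal (hsR x ^ (1 - (β + γ)))) := by
        apply lintegral_mono
        intro x
        simp only
        have hwx : Measurable fun τ : ℝ => w (x - τ • v) := hwm.comp (by fun_prop)
        rw [lintegral_const_mul _ (by fun_prop), lintegral_const_mul _ (by fun_prop)]
        have hin : ∫⁻ τ in Set.Ici (0:ℝ), w (x - τ • v) ≤ B * ENNReal.ofReal (hsR x ^ (1 - (β + γ))) := by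
          by_cases hx : hsR x = 0
          · have : ∀ τ : ℝ, w (x - τ • v) = 0 := by
              intro τ
              simp only [hw, hRv, hx]
              rw [if_neg (not_lt.2 (abs_nonneg _)), zero_mul]
            simp [this]
          have hxp : 0 < hsR x := lt_of_le_of_ne (hsR_nonneg x) (Ne.symm hx)
          calc _ ≤ ∫⁻ τ : ℝ, w (x - τ • v) := setLIntegral_le_lintegral _ _
            _ = (∫⁻ τ : ℝ, (if |x 2 - τ| < hsR x then ENNReal.ofReal (|x 2 - τ| ^ (-β)) else 0)) *
                ENNReal.ofReal (hsR x ^ (-γ)) := by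
              rw [← lintegral_mul_const' _ _ (by finiteness)]
              simp only [hw, hRv]
              simp [hv]
            _ = (∫⁻ τ : ℝ, (if |τ| < hsR x then ENNReal.ofReal (|τ| ^ (-β)) else 0)) *
                ENNReal.ofReal (hsR x ^ (-γ)) := by
              congr 1
              exact lintegral_sub_left_eq_self (μ := volume)
                (fun τ : ℝ => if |τ| < hsR x then ENNReal.ofReal (|τ| ^ (-β)) else 0) (x 2)
            _ ≤ (B * ENNReal.ofReal (hsR x ^ (1 - β))) * ENNReal.ofReal (hsR x ^ (-γ)) := by
              gcongr
              exact hB _ hxp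
            _ = _ := by
              rw [mul_assoc, ← ENNReal.ofReal_mul (by positivity), ← Real.rpow_add hxp]
              ring_nf
        calc _ ≤ ENNReal.ofReal q * (H x * (B * ENNReal.ofReal (hsR x ^ (1 - (β + γ))))) := by gcongr
          _ = _ := by ring
    _ = _ := by
        rw [lintegral_const_mul' _ _ (by finiteness)]

/-- weighted integral -/
def hsJ (f : (Fin 3 → ℝ) → ℝ) (q c : ℝ) : ℝ≥0∞ :=
  ∫⁻ x, ‖f x‖ₑ ^ q * ENNReal.ofReal (hsR x ^ (-c))

/-- Dirichlet energy -/
def hsE (f : (Fin 3 → ℝ) → ℝ) : ℝ≥0∞ := ∫⁻ x, ‖fderiv ℝ f x‖ₑ ^ (2:ℝ)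

lemma hs_cs (f : (Fin 3 → ℝ) → ℝ) (hf : ContDiff ℝ 1 f) (q c : ℝ) :
    ∫⁻ x, ‖f x‖ₑ ^ (q - 1) * ‖fderiv ℝ f x‖ₑ * ENNReal.ofReal (hsR x ^ (1 - c)) ≤
      hsJ f (2 * q - 2) (2 * c - 2) ^ (1 / 2 : ℝ) * hsE f ^ (1 / 2 : ℝ) := by
  have hcf : Continuous (fderiv ℝ f) := hf.continuous_fderiv one_ne_zero
  have h1 := hf.continuous.measurable
  have h2 := hcf.measurable
  have h3 := hsR_meas
  have := ENNReal.lintegral_mul_norm_pow_le (μ := (volume : Measure (Fin 3 → ℝ)))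
    (f := fun x => ‖f x‖ₑ ^ (2 * q - 2) * ENNReal.ofReal (hsR x ^ (-(2 * c - 2))))
    (g := fun x => ‖fderiv ℝ f x‖ₑ ^ (2:ℝ)) (p := 1 / 2) (q := 1 / 2) (by fun_prop) (by fun_prop)
    (by norm_num) (by norm_num) (by norm_num)
  refine le_trans (le_of_eq ?_) this
  congr! 2 with x
  rw [ENNReal.mul_rpow_of_nonneg _ _ (by norm_num), ← ENNReal.rpow_mul, ← ENNReal.rpow_mul,
    ENNReal.ofReal_rpow_of_nonneg (Real.rpow_nonneg (hsR_nonneg x) _) (by norm_num),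
    ← Real.rpow_mul (hsR_nonneg x)]
  rw [show (2 * q - 2) * (1 / 2) = q - 1 by ring, show (2:ℝ) * (1 / 2) = 1 by ring,
    show -(2 * c - 2) * (1 / 2) = 1 - c by ring, ENNReal.rpow_one]
  ring

/-- the scale of one-weight inequalities -/
def HSP (c : ℝ) : Prop := ∃ K : NNReal, ∀ f : (Fin 3 → ℝ) → ℝ, ContDiff ℝ 1 f →
  HasCompactSupport f → hsJ f (6 - 2 * c) c ≤ K * hsE f ^ (3 - c)

lemma hsp_zero : HSP 0 := by
  set S := SNormLESNormFDerivOfEqConst ℝ (volume : Measure (Fin 3 → ℝ)) 2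
  refine ⟨S ^ 6, fun f hf hc => ?_⟩
  have h := eLpNorm_le_eLpNorm_fderiv_of_eq (μ := (volume : Measure (Fin 3 → ℝ))) hf hc
    (p := 2) (p' := 6) (by norm_num) (by simp) (by simp; norm_num)
  have h6 : ((6 : NNReal) : ℝ≥0∞) = 6 := rfl
  have h2 : ((2 : NNReal) : ℝ≥0∞) = 2 := rfl
  rw [h6, h2, eLpNorm_eq_lintegral_rpow_enorm_toReal (by norm_num) (by norm_num),
    eLpNorm_eq_lintegral_rpow_enorm_toReal (by norm_num) (by norm_num)] at h
  have h' := ENNReal.rpow_le_rpow h (z := 6) (by norm_num)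
  rw [ENNReal.mul_rpow_of_nonneg _ _ (by norm_num), ← ENNReal.rpow_mul, ← ENNReal.rpow_mul] at h'
  norm_num at h'
  simp only [hsJ, hsE]
  norm_num
  exact_mod_cast h'

lemma hsp_step (c : ℝ) (hc0 : 0 < c) (hc2 : c < 2) (h : HSP (2 * c - 2)) : HSP c := by
  obtain ⟨K, hK⟩ := h
  obtain ⟨L, hL⟩ := horiz c (6 - 2 * c) hc0 hc2 (by linarith)
  refine ⟨L * K ^ (1 / 2 : ℝ), fun f hf hc => ?_⟩
  have h1 := hL f hf hc
  have h2 := hs_cs f hf (6 - 2 * c) c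
  have h3 := hK f hf hc
  rw [show 6 - 2 * (2 * c - 2) = 2 * (6 - 2 * c) - 2 by ring] at h3
  calc hsJ f (6 - 2 * c) c ≤ _ := h1
    _ ≤ L * ((K * hsE f ^ (3 - (2 * c - 2))) ^ (1 / 2 : ℝ) * hsE f ^ (1 / 2 : ℝ)) := by
        gcongr
        exact h2.trans (by gcongr)
    _ = _ := by
        rw [ENNReal.mul_rpow_of_nonneg _ _ (by norm_num), ← ENNReal.rpow_mul, mul_assoc,
          ← ENNReal.rpow_add_of_nonneg _ _ (by nlinarith) (by norm_num), ENNReal.coe_mul,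
          ENNReal.coe_rpow_of_nonneg _ (by norm_num), mul_assoc]
        congr 3
        ring

lemma hsp_interp (c : ℝ) (hc0 : 0 ≤ c) (hc1 : c ≤ 1) (h0 : HSP 0) (h1 : HSP 1) : HSP c := by
  obtain ⟨K, hK⟩ := h0
  obtain ⟨L, hL⟩ := h1
  refine ⟨L ^ c * K ^ (1 - c), fun f hf hc => ?_⟩
  have m1 := hf.continuous.measurable
  have m3 := hsR_meas
  have := ENNReal.lintegral_mul_norm_pow_le (μ := (volume : Measure (Fin 3 → ℝ)))
    (f := fun x => ‖f x‖ₑ ^ (6 - 2 * 1 : ℝ) * ENNReal.ofReal (hsR x ^ (-1 : ℝ)))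
    (g := fun x => ‖f x‖ₑ ^ (6 - 2 * 0 : ℝ) * ENNReal.ofReal (hsR x ^ (-0 : ℝ)))
    (p := c) (q := 1 - c) (by fun_prop) (by fun_prop)
    hc0 (by linarith) (by ring)
  calc hsJ f (6 - 2 * c) c = _ := by
        unfold hsJ
        congr! 2 with x
        rw [ENNReal.mul_rpow_of_nonneg _ _ hc0, ENNReal.mul_rpow_of_nonneg _ _ (by linarith),
          ← ENNReal.rpow_mul, ← ENNReal.rpow_mul,
          ENNReal.ofReal_rpow_of_nonneg (Real.rpow_nonneg (hsR_nonneg x) _) hc0,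
          ← Real.rpow_mul (hsR_nonneg x)]
        simp only [neg_zero, Real.rpow_zero, ENNReal.ofReal_one, ENNReal.one_rpow, mul_one]
        rw [mul_right_comm, ← ENNReal.rpow_add_of_nonneg _ _ (by nlinarith) (by nlinarith)]
        congr 2 <;> ring_nf
    _ ≤ _ := this
    _ ≤ (L * hsE f ^ (3 - 1 : ℝ)) ^ c * (K * hsE f ^ (3 - 0 : ℝ)) ^ (1 - c) := by
        gcongr
        · exact hL f hf hc
        · exact hK f hf hc
    _ = _ := by
        rw [ENNReal.mul_rpow_of_nonneg _ _ hc0, ENNReal.mul_rpow_of_nonneg _ _ (by linarith),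
          ← ENNReal.rpow_mul, ← ENNReal.rpow_mul, mul_mul_mul_comm,
          ← ENNReal.rpow_add_of_nonneg _ _ (by nlinarith) (by nlinarith), ENNReal.coe_mul,
          ENNReal.coe_rpow_of_nonneg _ hc0, ENNReal.coe_rpow_of_nonneg _ (by linarith)]
        congr 2
        ring

/-- the integral form of the two-weight inequality -/
lemma hs_main (β γ : ℝ) (hβ0 : 0 < β) (hβ1 : β < 1) (hγ : 0 < γ) (hs1 : 3 / 2 < β + γ)
    (hs2 : β + γ < 7 / 4) : ∃ K : NNReal,
    ∀ f : (Fin 3 → ℝ) → ℝ, ContDiff ℝ 1 f → HasCompactSupport f →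
    ∫⁻ x, ‖f x‖ₑ ^ (6 - 2 * (β + γ)) * (ENNReal.ofReal (|x 2| ^ (-β))
        * ENNReal.ofReal (hsR x ^ (-γ))) ≤ K * hsE f ^ (3 - (β + γ)) := by
  set s := β + γ with hs
  have p0 := hsp_zero
  have p1 : HSP 1 := hsp_step 1 (by norm_num) (by norm_num) (by norm_num; exact p0)
  have p2 : HSP (2 * (2 * s - 2) - 2) := hsp_interp _ (by linarith) (by linarith) p0 p1
  have p3 : HSP (2 * s - 2) := hsp_step _ (by linarith) (by linarith) p2
  obtain ⟨A, hA⟩ := hsp_step s (by linarith) (by linarith) p3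
  obtain ⟨K, hK⟩ := p3
  obtain ⟨L, hL⟩ := vert β γ (6 - 2 * s) hβ1 (by linarith)
  refine ⟨A + L * K ^ (1 / 2 : ℝ), fun f hf hc => ?_⟩
  have h1 := hL f hf hc
  have h2 := hs_cs f hf (6 - 2 * s) s
  have h3 := hK f hf hc
  have m1 := hf.continuous.measurable
  have m3 := hsR_meas
  rw [show 6 - 2 * (2 * s - 2) = 2 * (6 - 2 * s) - 2 by ring] at h3
  have h4 : ∫⁻ x, ‖f x‖ₑ ^ (6 - 2 * s) * (if |x 2| < hsR x then ENNReal.ofReal (|x 2| ^ (-β)) else 0)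
        * ENNReal.ofReal (hsR x ^ (-γ)) ≤ L * K ^ (1 / 2 : ℝ) * hsE f ^ (3 - s) := by
    refine h1.trans ?_
    calc _ ≤ L * ((K * hsE f ^ (3 - (2 * s - 2))) ^ (1 / 2 : ℝ) * hsE f ^ (1 / 2 : ℝ)) := by
          gcongr
          exact h2.trans (by gcongr)
      _ = _ := by
          rw [ENNReal.mul_rpow_of_nonneg _ _ (by norm_num), ← ENNReal.rpow_mul, mul_assoc, mul_assoc,
            ← ENNReal.rpow_add_of_nonneg _ _ (by nlinarith) (by norm_num)]
          congr 3
          ring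
  calc _ ≤ ∫⁻ x, (‖f x‖ₑ ^ (6 - 2 * s) * ENNReal.ofReal (hsR x ^ (-s)) +
        ‖f x‖ₑ ^ (6 - 2 * s) * (if |x 2| < hsR x then ENNReal.ofReal (|x 2| ^ (-β)) else 0)
        * ENNReal.ofReal (hsR x ^ (-γ))) := by
        apply lintegral_mono
        intro x
        simp only
        by_cases hx : |x 2| < hsR x
        · rw [if_pos hx, mul_assoc]
          exact le_add_self
        · rw [if_neg hx]
          refine le_trans ?_ le_self_add
          gcongr
          rw [← ENNReal.ofReal_mul (by positivity)]
          apply ENNReal.ofReal_le_ofReal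
          by_cases hx0 : hsR x = 0
          · rw [hx0, Real.zero_rpow (by linarith), Real.zero_rpow (by linarith), mul_zero]
          have hxp : 0 < hsR x := lt_of_le_of_ne (hsR_nonneg x) (Ne.symm hx0)
          rw [show -s = -β + -γ by rw [hs]; ring, Real.rpow_add hxp]
          have := Real.rpow_le_rpow_of_nonpos hxp (not_lt.1 hx) (by linarith : -β ≤ 0)
          gcongr
    _ = _ := lintegral_add_left (by fun_prop) _
    _ ≤ A * hsE f ^ (3 - s) + L * K ^ (1 / 2 : ℝ) * hsE f ^ (3 - s) := add_le_add (hA f hf hc) h4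
    _ = _ := by
        rw [ENNReal.coe_add, ENNReal.coe_mul, ENNReal.coe_rpow_of_nonneg _ (by norm_num), add_mul]

end

theorem hardy_sobolev_mixed_weight_H1
    (α : ℝ) (hα0 : 0 < α) (hα : α < 1 / 4) :
    ∃ C : ℝ, 0 < C ∧ ∀ f : (Fin 3 → ℝ) → ℝ,
      ContDiff ℝ (⊤ : ℕ∞) f → HasCompactSupport f →
      eLpNorm (fun x => f x / (|x 2| ^ (α / 2) * (x 0 ^ 2 + x 1 ^ 2) ^ ((1 : ℝ) / 4)))
          (ENNReal.ofReal (6 / (2 + α))) volume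
        ≤ ENNReal.ofReal C * eLpNorm (fderiv ℝ f) 2 volume := by
  have h2α : 0 < 2 + α := by linarith
  set β := 3 * α / (2 + α) with hβ
  set γ := 3 / (2 + α) with hγ
  set p := 6 / (2 + α) with hp
  have hp0 : 0 < p := by positivity
  have e1 : 6 - 2 * (β + γ) = p := by rw [hβ, hγ, hp]; field_simp; ring
  have e2 : 3 - (β + γ) = p / 2 := by linarith
  have eβ : α / 2 * p = β := by rw [hβ, hp]; field_simp; ring
  have eγ : 1 / 2 * p = γ := by rw [hγ, hp]; field_simp; ring
  obtain ⟨K, hK⟩ := hs_main β γ (by positivity)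
    (by rw [hβ, div_lt_one h2α]; linarith) (by positivity)
    (by rw [hβ, hγ, ← add_div, lt_div_iff₀ h2α]; linarith)
    (by rw [hβ, hγ, ← add_div, div_lt_iff₀ h2α]; linarith)
  refine ⟨(K : ℝ) ^ (1 / p) + 1, by positivity, fun f hf hc => ?_⟩
  have h := hK f (hf.of_le (by exact_mod_cast le_top)) hc
  rw [e1, e2] at h
  rw [eLpNorm_eq_lintegral_rpow_enorm_toReal (by simpa using hp0) (by simp),
    eLpNorm_eq_lintegral_rpow_enorm_toReal (by norm_num) (by norm_num),
    ENNReal.toReal_ofReal hp0.le]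
  have hL : ∫⁻ x : Fin 3 → ℝ, ‖f x / (|x 2| ^ (α / 2) * (x 0 ^ 2 + x 1 ^ 2) ^ ((1 : ℝ) / 4))‖ₑ ^ p =
      ∫⁻ x, ‖f x‖ₑ ^ p * (ENNReal.ofReal (|x 2| ^ (-β)) * ENNReal.ofReal (hsR x ^ (-γ))) := by
    congr! 2 with x
    have n1 : 0 ≤ x 0 ^ 2 + x 1 ^ 2 := by positivity
    have r1 : (x 0 ^ 2 + x 1 ^ 2) ^ ((1 : ℝ) / 4) = hsR x ^ (1 / 2 : ℝ) := by
      rw [hsR, Real.sqrt_eq_rpow, ← Real.rpow_mul n1]; norm_num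
    have hR := hsR_nonneg x
    rw [r1, div_eq_mul_inv, mul_inv, ← Real.rpow_neg (abs_nonneg _), ← Real.rpow_neg hR,
      enorm_mul, enorm_mul, ENNReal.mul_rpow_of_nonneg _ _ hp0.le,
      ENNReal.mul_rpow_of_nonneg _ _ hp0.le,
      Real.enorm_of_nonneg (Real.rpow_nonneg (abs_nonneg _) _), Real.enorm_of_nonneg (Real.rpow_nonneg hR _),
      ENNReal.ofReal_rpow_of_nonneg (Real.rpow_nonneg (abs_nonneg _) _) hp0.le,
      ENNReal.ofReal_rpow_of_nonneg (Real.rpow_nonneg hR _) hp0.le,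
      ← Real.rpow_mul (abs_nonneg _), ← Real.rpow_mul hR, neg_mul, neg_mul, eβ, eγ]
  rw [hL]
  have h' := ENNReal.rpow_le_rpow h (z := 1 / p) (by positivity)
  refine h'.trans ?_
  rw [ENNReal.mul_rpow_of_nonneg _ _ (by positivity), ← ENNReal.rpow_mul,
    show p / 2 * (1 / p) = 1 / 2 by field_simp]
  have e3 : (2 : ℝ≥0∞).toReal = 2 := by norm_num
  rw [e3]
  unfold hsE
  gcongr
  rw [← ENNReal.ofReal_coe_nnreal, ENNReal.ofReal_rpow_of_nonneg (by positivity) (by positivity)]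
  apply ENNReal.ofReal_le_ofReal
  linarith
end
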